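/- (Critical scaling parameter) Let u ∈ ℝ^d with u ≥ 0 componentwise and u ≠ 0. Then there exists λ_c > 0 such that: (a) for every λ with 0 < λ < λ_c, the maximal solution U^{λu} of system (1.1) is global and U^{λu}(t) → 0 as t → ∞; (b) for every λ > λ_c, the maximal solution U^{λu} blows up in finite time; (c) the maximal solution U^{λ_c u} is global and U^{λ_c u}(t) → 𝟙 as t → ∞. -/

import Mathlib

open scoped BigOperators
open Filter Topology Set

/-- The `n`-th coordinate (0-based) of a vector in `ℝ^d`, with junk value `0` out of range. -/
noncomputable def coordFn {d : ℕ} (u : Fin d → ℝ) (n : ℕ) : ℝ :=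
  if hn : n < d then u ⟨n, hn⟩ else 0

/-- The vector field `b` of system (1.1) (0-based indices: coordinate `1 ≤ k ≤ d` of the paper
is coordinate `k - 1` here). -/
noncomputable def bField (d : ℕ) (h p : ℝ) (u : Fin d → ℝ) (i : Fin d) : ℝ :=
  if (i : ℕ) = 0 then (2 / h ^ 2) * (-coordFn u 0 + coordFn u 1)
  else if (i : ℕ) = d - 1 then
    (2 / h ^ 2) * (-coordFn u (d - 1) + coordFn u (d - 2)
      + h * ((max (coordFn u (d - 1)) 0) ^ p - coordFn u (d - 1)))
  else (1 / h ^ 2) * (coordFn u ((i : ℕ) + 1) - 2 * coordFn u (i : ℕ) + coordFn u ((i : ℕ) - 1))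

/-- The Euclidean norm on `ℝ^d`. -/
noncomputable def euclNorm {d : ℕ} (u : Fin d → ℝ) : ℝ := Real.sqrt (∑ i, (u i) ^ 2)

/-- `u` belongs to the domain of explosion `D_e`: the (unique, maximal) solution of (1.1)
starting at `u` blows up in finite time, i.e. there are `τ < ∞` and a solution `U` of (1.1)
on `[0, τ)` with `U(0) = u` and `|U(t)| → ∞` as `t → τ⁻`. -/
def BlowsUp (d : ℕ) (h p : ℝ) (u : Fin d → ℝ) : Prop :=
  ∃ (τ : ℝ) (U : ℝ → Fin d → ℝ), 0 < τ ∧ U 0 = u ∧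
    (∀ t ∈ Set.Ico 0 τ, HasDerivWithinAt U (bField d h p (U t)) (Set.Ico 0 τ) t) ∧
    Filter.Tendsto (fun t => euclNorm (U t)) (nhdsWithin τ (Set.Iio τ)) Filter.atTop

/-- The (unique, maximal) solution of (1.1) starting at `u` is global and converges to `L`
as `t → ∞`. -/
def GlobalTo (d : ℕ) (h p : ℝ) (u L : Fin d → ℝ) : Prop :=
  ∃ U : ℝ → Fin d → ℝ, U 0 = u ∧
    (∀ t : ℝ, 0 ≤ t → HasDerivWithinAt U (bField d h p (U t)) (Set.Ici 0) t) ∧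
    Filter.Tendsto U Filter.atTop (nhds L)

/-- On every ball the vector field `b` agrees with a bounded, globally Lipschitz vector field. -/
def LocallyTame {E : Type*} [NormedAddCommGroup E] (b : E → E) : Prop :=
  ∀ M : ℝ, ∃ (F : E → E) (L C : NNReal), LipschitzWith L F ∧ (∀ x, ‖F x‖ ≤ C) ∧
    ∀ x, ‖x‖ ≤ M → F x = b x

section ODE

variable {E : Type*} [NormedAddCommGroup E] [NormedSpace ℝ E]

theorem IsIntegralCurveOn.continuousOn_curve {b : E → E} {U : ℝ → E} {s : Set ℝ}
    (hU : IsIntegralCurveOn U (fun _ => b) s) : ContinuousOn U s :=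
  fun t ht => (hU t ht).continuousWithinAt

theorem HasDerivWithinAt.Ici_of_Icc {F : Type*} [NormedAddCommGroup F] [NormedSpace ℝ F]
    {f : ℝ → F} {f' : F} {a T t : ℝ}
    (hf : HasDerivWithinAt f f' (Icc a T) t) (ht : t ∈ Ico a T) :
    HasDerivWithinAt f f' (Ici t) t :=
  hf.mono_of_mem_nhdsWithin (mem_of_superset (Icc_mem_nhdsGE ht.2)
    (Icc_subset_Icc_left ht.1))

theorem IsIntegralCurveOn.congr_field {b c : E → E} {U : ℝ → E} {s : Set ℝ}
    (hU : IsIntegralCurveOn U (fun _ => b) s) (h : ∀ t ∈ s, b (U t) = c (U t)) :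
    IsIntegralCurveOn U (fun _ => c) s := fun t ht => by
  have := hU t ht
  simp only [h t ht] at this
  exact this

theorem IsIntegralCurveOn.exists_norm_le {b : E → E} {U : ℝ → E} {a T : ℝ}
    (hU : IsIntegralCurveOn U (fun _ => b) (Icc a T)) : ∃ M, ∀ t ∈ Icc a T, ‖U t‖ ≤ M :=
  isCompact_Icc.exists_bound_of_continuousOn hU.continuousOn_curve

theorem exists_integralCurve_of_bounded_lipschitz [CompleteSpace E] {F : E → E} {L C : NNReal}
    (hL : LipschitzWith L F) (hC : ∀ x, ‖F x‖ ≤ C) (x : E) {T : ℝ} (hT : 0 ≤ T) :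
    ∃ U : ℝ → E, U 0 = x ∧ IsIntegralCurveOn U (fun _ => F) (Icc 0 T) := by
  have hP : IsPicardLindelof (fun _ => F) (⟨0, le_refl 0, hT⟩ : Icc (0 : ℝ) T) x
      (C * T.toNNReal) 0 C L :=
    IsPicardLindelof.of_time_independent (fun y _ => hC y) hL.lipschitzOnWith (by
      simp [Real.coe_toNNReal _ hT, hT])
  exact hP.exists_eq_forall_mem_Icc_hasDerivWithinAt₀

theorem IsIntegralCurveOn.dist_le {F : E → E} {L : NNReal} (hL : LipschitzWith L F)
    {U V : ℝ → E} {T : ℝ} (hU : IsIntegralCurveOn U (fun _ => F) (Icc 0 T))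
    (hV : IsIntegralCurveOn V (fun _ => F) (Icc 0 T)) {t : ℝ} (ht : t ∈ Icc 0 T) :
    dist (U t) (V t) ≤ dist (U 0) (V 0) * Real.exp (L * t) := by
  have := dist_le_of_trajectories_ODE (v := fun _ => F) (fun _ => hL) hU.continuousOn_curve
    (fun t ht => (hU t (Ico_subset_Icc_self ht)).Ici_of_Icc ht) hV.continuousOn_curve
    (fun t ht => (hV t (Ico_subset_Icc_self ht)).Ici_of_Icc ht) le_rfl t ht
  simpa using this

theorem IsIntegralCurveOn.eqOn_of_tame {b : E → E} (hb : LocallyTame b) {U V : ℝ → E} {T : ℝ}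
    (hU : IsIntegralCurveOn U (fun _ => b) (Icc 0 T))
    (hV : IsIntegralCurveOn V (fun _ => b) (Icc 0 T)) (h0 : U 0 = V 0) :
    EqOn U V (Icc 0 T) := by
  intro t ht
  obtain ⟨M, hM⟩ := hU.exists_norm_le
  obtain ⟨N, hN⟩ := hV.exists_norm_le
  obtain ⟨F, L, C, hL, -, hF⟩ := hb (max M N)
  have h := IsIntegralCurveOn.dist_le hL
    (hU.congr_field fun t ht => (hF _ ((hM t ht).trans (le_max_left _ _))).symm)
    (hV.congr_field fun t ht => (hF _ ((hN t ht).trans (le_max_right _ _))).symm) ht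
  rw [h0, dist_self, zero_mul] at h
  exact dist_le_zero.1 h

/-- Continuous dependence on the initial condition. -/
theorem IsIntegralCurveOn.exists_nearby [CompleteSpace E] {b : E → E} (hb : LocallyTame b)
    {U : ℝ → E} {T : ℝ} (hT : 0 ≤ T) (hU : IsIntegralCurveOn U (fun _ => b) (Icc 0 T))
    {ε : ℝ} (hε : 0 < ε) :
    ∃ δ > 0, ∀ y, dist y (U 0) < δ → ∃ V : ℝ → E, V 0 = y ∧
      IsIntegralCurveOn V (fun _ => b) (Icc 0 T) ∧ ∀ t ∈ Icc 0 T, dist (V t) (U t) < ε := by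
  obtain ⟨M, hM⟩ := hU.exists_norm_le
  obtain ⟨F, L, C, hL, hC, hF⟩ := hb (M + ε)
  refine ⟨ε * Real.exp (-(L * T)), by positivity, fun y hy => ?_⟩
  obtain ⟨V, hV0, hV⟩ := exists_integralCurve_of_bounded_lipschitz hL hC y hT
  have hd : ∀ t ∈ Icc 0 T, dist (V t) (U t) < ε := fun t ht => by
    have h := IsIntegralCurveOn.dist_le hL hV
      (hU.congr_field fun t ht => (hF _ ((hM t ht).trans (by linarith))).symm) ht
    rw [hV0] at h
    calc dist (V t) (U t) ≤ dist y (U 0) * Real.exp (L * t) := h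
      _ ≤ dist y (U 0) * Real.exp (L * T) := by
          have := ht.2
          gcongr
      _ < ε * Real.exp (-(L * T)) * Real.exp (L * T) := by gcongr
      _ = ε := by rw [mul_assoc, ← Real.exp_add]; simp
  refine ⟨V, hV0, hV.congr_field fun t ht => hF _ ?_, hd⟩
  have h1 := hd t ht
  have h2 := hM t ht
  rw [dist_eq_norm] at h1
  have h3 := norm_add_le (V t - U t) (U t)
  rw [sub_add_cancel] at h3
  linarith

theorem exists_extension_of_bounded [CompleteSpace E] {b : E → E} (hb : LocallyTame b) {x : E}
    {M T : ℝ} (hT : 0 ≤ T) (hx : ‖x‖ ≤ M)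
    (h : ∀ t ∈ Ico 0 T, ∃ U : ℝ → E, U 0 = x ∧ IsIntegralCurveOn U (fun _ => b) (Icc 0 t) ∧
      ∀ s ∈ Icc 0 t, ‖U s‖ ≤ M) :
    ∃ T' > T, ∃ U : ℝ → E, U 0 = x ∧ IsIntegralCurveOn U (fun _ => b) (Icc 0 T') := by
  obtain ⟨F, L, C, hL, hC, hF⟩ := hb (M + 1)
  obtain ⟨V, hV0, hV⟩ := exists_integralCurve_of_bounded_lipschitz hL hC x
    (T := T + 1) (by linarith)
  have h1 : ∀ t ∈ Ico 0 T, ‖V t‖ ≤ M := fun t ht => by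
    obtain ⟨U, hU0, hU, hUM⟩ := h t ht
    have := IsIntegralCurveOn.dist_le hL
      (hU.congr_field fun s hs => (hF _ ((hUM s hs).trans (by linarith))).symm)
      (hV.mono (Icc_subset_Icc_right (by linarith [ht.2]))) (right_mem_Icc.2 ht.1)
    rw [hU0, hV0, dist_self, zero_mul] at this
    rw [← dist_le_zero.1 this]
    exact hUM t (right_mem_Icc.2 ht.1)
  have hcont := hV.continuousOn_curve
  have h2 : ‖V T‖ ≤ M := by
    rcases hT.eq_or_lt with rfl | hT'
    · rwa [hV0]
    · have hc : ContinuousWithinAt (fun t => ‖V t‖) (Ico 0 T) T :=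
        ((hcont T ⟨hT, by linarith⟩).mono fun t ht => ⟨ht.1, by linarith [ht.2]⟩).norm
      have : (𝓝[Ico 0 T] T).NeBot := by
        rw [← mem_closure_iff_nhdsWithin_neBot, closure_Ico hT'.ne]
        exact right_mem_Icc.2 hT
      exact le_of_tendsto hc (eventually_mem_nhdsWithin.mono h1)
  have h3 : ∀ᶠ t in 𝓝[≥] T, ‖V t‖ < M + 1 := by
    have hc : ContinuousWithinAt (fun t => ‖V t‖) (Icc T (T + 1)) T :=
      ((hcont T ⟨hT, by linarith⟩).mono (Icc_subset_Icc_left hT)).norm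
    have := hc.eventually (gt_mem_nhds (show ‖V T‖ < M + 1 by linarith))
    rwa [nhdsWithin_Icc_eq_nhdsGE (by linarith)] at this
  obtain ⟨T', hT', h4⟩ := mem_nhdsGE_iff_exists_Icc_subset.1 h3
  refine ⟨min T' (T + 1), lt_min hT' (by linarith), V, hV0,
    (hV.mono (Icc_subset_Icc_right (min_le_right _ _))).congr_field fun t ht => hF _ ?_⟩
  rcases lt_or_ge t T with h5 | h5
  · linarith [h1 t ⟨ht.1, h5⟩]
  · exact (h4 ⟨h5, ht.2.trans (min_le_left _ _)⟩).le

theorem exists_integralCurveOn_glue {b : E → E} (hb : LocallyTame b) {x : E} {I : Set ℝ}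
    (h0 : 0 ∈ I) (hI : ∀ t ∈ I, 0 ≤ t ∧ ∃ T > t, ∃ U : ℝ → E, U 0 = x ∧
      IsIntegralCurveOn U (fun _ => b) (Icc 0 T)) :
    ∃ U : ℝ → E, U 0 = x ∧ IsIntegralCurveOn U (fun _ => b) I := by
  have hI0 := fun t ht => (hI t ht).1
  choose! T hT V hV0 hV using fun t ht => (hI t ht).2
  have key : ∀ t ∈ I, ∀ s ∈ I, s < T t → V s s = V t s := fun t ht s hs hst => by
    refine IsIntegralCurveOn.eqOn_of_tame hb
      ((hV s hs).mono (Icc_subset_Icc_right (hT s hs).le))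
      ((hV t ht).mono (Icc_subset_Icc_right hst.le)) ?_ (right_mem_Icc.2 (hI0 s hs))
    rw [hV0 s hs, hV0 t ht]
  refine ⟨fun t => V t t, hV0 0 h0, fun t ht => ?_⟩
  have h1 : HasDerivWithinAt (V t) (b (V t t)) (I ∩ Iio (T t)) t :=
    (hV t ht t ⟨hI0 t ht, (hT t ht).le⟩).mono fun s hs => ⟨hI0 s hs.1, le_of_lt hs.2⟩
  have h2 : HasDerivWithinAt (V t) (b (V t t)) I t :=
    h1.mono_of_mem_nhdsWithin (inter_mem self_mem_nhdsWithin
      (mem_nhdsWithin_of_mem_nhds (Iio_mem_nhds (hT t ht))))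
  refine h2.congr_of_eventuallyEq ?_ rfl
  filter_upwards [self_mem_nhdsWithin, mem_nhdsWithin_of_mem_nhds (Iio_mem_nhds (hT t ht))]
    with s hs hs'
  exact key t ht s hs hs'

/-- A maximal solution is either global or unbounded in finite time. -/
theorem exists_global_or_unbounded [CompleteSpace E] {b : E → E} (hb : LocallyTame b) (x : E) :
    (∃ U : ℝ → E, U 0 = x ∧ IsIntegralCurveOn U (fun _ => b) (Ici 0)) ∨
    ∃ (τ : ℝ) (U : ℝ → E), 0 < τ ∧ U 0 = x ∧ IsIntegralCurveOn U (fun _ => b) (Ico 0 τ) ∧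
      ∀ M, ∃ t ∈ Ico 0 τ, M < ‖U t‖ := by
  set S : Set ℝ := {T | 0 < T ∧ ∃ U : ℝ → E, U 0 = x ∧
    IsIntegralCurveOn U (fun _ => b) (Icc 0 T)} with hS
  obtain ⟨T₀, hT₀, hST₀⟩ := exists_extension_of_bounded hb le_rfl (le_refl ‖x‖) (by simp)
  have hT₀S : T₀ ∈ S := ⟨hT₀, hST₀⟩
  by_cases hbd : BddAbove S
  · right
    have hτ : 0 < sSup S := lt_of_lt_of_le hT₀ (le_csSup hbd hT₀S)
    obtain ⟨U, hU0, hU⟩ := exists_integralCurveOn_glue hb (x := x) (I := Ico 0 (sSup S))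
      ⟨le_rfl, hτ⟩ fun t ht => by
        obtain ⟨T, hTS, htT⟩ := exists_lt_of_lt_csSup ⟨T₀, hT₀S⟩ ht.2
        exact ⟨ht.1, T, htT, hTS.2⟩
    refine ⟨sSup S, U, hτ, hU0, hU, ?_⟩
    by_contra! hM
    obtain ⟨M, hM⟩ := hM
    obtain ⟨T', hT', hU'⟩ := exists_extension_of_bounded hb hτ.le (x := x)
      (hU0 ▸ hM 0 ⟨le_rfl, hτ⟩) fun t ht => ⟨U, hU0,
        hU.mono fun s hs => ⟨hs.1, hs.2.trans_lt ht.2⟩,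
        fun s hs => hM s ⟨hs.1, hs.2.trans_lt ht.2⟩⟩
    exact absurd (le_csSup hbd (show T' ∈ S from ⟨hτ.trans hT', hU'⟩)) (not_le.2 hT')
  · left
    refine exists_integralCurveOn_glue hb self_mem_Ici fun t ht => ⟨ht, ?_⟩
    obtain ⟨T, hTS, htT⟩ := not_bddAbove_iff.1 hbd t
    exact ⟨T, htT, hTS.2⟩

end ODE
section ScalarInequalities

theorem hasDerivAt_max_zero_sq (z : ℝ) :
    HasDerivAt (fun x : ℝ => max x 0 ^ 2) (2 * max z 0) z := by
  rcases lt_trichotomy z 0 with hz | rfl | hz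
  · rw [max_eq_right hz.le, mul_zero]
    refine (hasDerivAt_const z (0 : ℝ)).congr_of_eventuallyEq ?_
    filter_upwards [Iio_mem_nhds hz] with x hx
    simp [max_eq_right (mem_Iio.1 hx).le]
  · have h : (fun x : ℝ => max x 0 ^ 2) =O[𝓝 0] fun x => x ^ 2 := by
      refine Asymptotics.IsBigO.of_bound 1 (Eventually.of_forall fun x => ?_)
      rw [one_mul, norm_pow, norm_pow]
      gcongr
      rw [Real.norm_eq_abs, Real.norm_eq_abs, abs_of_nonneg (le_max_right _ _)]
      exact max_le (le_abs_self x) (abs_nonneg x)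
    rw [max_self, mul_zero, hasDerivAt_iff_isLittleO]
    simpa using h.trans_isLittleO (Asymptotics.isLittleO_pow_id one_lt_two)
  · rw [max_eq_left hz.le]
    have h : HasDerivAt (fun x : ℝ => x ^ 2) (2 * z) z := by simpa using hasDerivAt_pow 2 z
    refine h.congr_of_eventuallyEq ?_
    filter_upwards [Ioi_mem_nhds hz] with x hx
    simp [max_eq_left (mem_Ioi.1 hx).le]

variable {y y' : ℝ → ℝ} {a T C : ℝ}

theorem monotoneOn_Icc_of_hasDerivWithinAt
    (hy : ∀ t ∈ Icc a T, HasDerivWithinAt y (y' t) (Icc a T) t)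
    (h : ∀ t ∈ Ioo a T, 0 ≤ y' t) : MonotoneOn y (Icc a T) :=
  monotoneOn_of_hasDerivWithinAt_nonneg (convex_Icc a T)
    (fun t ht => (hy t ht).continuousWithinAt)
    (fun t ht => (hy t (interior_subset ht)).mono interior_subset)
    (fun t ht => h t (by rwa [interior_Icc] at ht))

theorem strictMonoOn_Icc_of_hasDerivWithinAt
    (hy : ∀ t ∈ Icc a T, HasDerivWithinAt y (y' t) (Icc a T) t)
    (h : ∀ t ∈ Ioo a T, 0 < y' t) : StrictMonoOn y (Icc a T) :=
  strictMonoOn_of_hasDerivWithinAt_pos (convex_Icc a T)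
    (fun t ht => (hy t ht).continuousWithinAt)
    (fun t ht => (hy t (interior_subset ht)).mono interior_subset)
    (fun t ht => h t (by rwa [interior_Icc] at ht))

theorem hasDerivWithinAt_exp_mul {s : Set ℝ} {t v : ℝ} (hy : HasDerivWithinAt y v s t) :
    HasDerivWithinAt (fun t => Real.exp (C * t) * y t) (Real.exp (C * t) * (v + C * y t)) s t := by
  have h1 : HasDerivWithinAt (fun t => Real.exp (C * t)) (Real.exp (C * t) * C) s t := by
    simpa using (((hasDerivAt_id t).const_mul C).exp).hasDerivWithinAt
  exact (h1.mul hy).congr_deriv (by ring)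

theorem exp_mul_le_of_deriv_ge (hy : ∀ t ∈ Icc a T, HasDerivWithinAt y (y' t) (Icc a T) t)
    (h : ∀ t ∈ Ioo a T, -C * y t ≤ y' t) {t : ℝ} (ht : t ∈ Icc a T) :
    Real.exp (C * a) * y a ≤ Real.exp (C * t) * y t :=
  monotoneOn_Icc_of_hasDerivWithinAt (fun t ht => hasDerivWithinAt_exp_mul (C := C) (hy t ht))
    (fun t ht => mul_nonneg (Real.exp_pos _).le (by linarith [h t ht]))
    (left_mem_Icc.2 (ht.1.trans ht.2)) ht ht.1

theorem pos_of_deriv_ge (hy : ∀ t ∈ Icc a T, HasDerivWithinAt y (y' t) (Icc a T) t)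
    (h : ∀ t ∈ Ioo a T, -C * y t ≤ y' t) (ha : 0 < y a) {t : ℝ} (ht : t ∈ Icc a T) :
    0 < y t := by
  have := exp_mul_le_of_deriv_ge hy h ht
  exact pos_of_mul_pos_right ((mul_pos (Real.exp_pos _) ha).trans_le this) (Real.exp_pos _).le

theorem pos_of_deriv_gt (hy : ∀ t ∈ Icc a T, HasDerivWithinAt y (y' t) (Icc a T) t)
    (h : ∀ t ∈ Ioo a T, -C * y t < y' t) (ha : 0 ≤ y a) {t : ℝ} (ht : t ∈ Ioc a T) :
    0 < y t := by
  have := strictMonoOn_Icc_of_hasDerivWithinAt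
    (fun t ht => hasDerivWithinAt_exp_mul (C := C) (hy t ht))
    (fun t ht => mul_pos (Real.exp_pos _) (by linarith [h t ht]))
    (left_mem_Icc.2 (ht.1.le.trans ht.2)) (Ioc_subset_Icc_self ht) ht.1
  exact pos_of_mul_pos_right ((mul_nonneg (Real.exp_pos _).le ha).trans_lt this)
    (Real.exp_pos _).le

theorem nonpos_of_deriv_le_mul (hy : ∀ t ∈ Icc a T, HasDerivWithinAt y (y' t) (Icc a T) t)
    (h : ∀ t ∈ Icc a T, y' t ≤ C * y t) (ha : y a ≤ 0) {t : ℝ} (ht : t ∈ Icc a T) :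
    y t ≤ 0 := by
  have h1 := exp_mul_le_of_deriv_ge (y := fun t => -y t) (C := -C) (fun t ht => (hy t ht).fun_neg)
    (fun t ht => by linarith [h t (Ioo_subset_Icc_self ht)]) ht
  have h2 : 0 ≤ Real.exp (-C * a) * -y a := mul_nonneg (Real.exp_pos _).le (by linarith)
  linarith [nonneg_of_mul_nonneg_right (h2.trans h1) (Real.exp_pos _)]

theorem le_of_deriv_pos_above (hy : ∀ t ∈ Icc a T, HasDerivWithinAt y (y' t) (Icc a T) t)
    {K : ℝ} (h : ∀ t ∈ Icc a T, K ≤ y t → 0 < y' t) (ha : K ≤ y a) {t : ℝ} (ht : t ∈ Icc a T) :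
    K ≤ y t := by
  have := image_le_of_deriv_right_lt_deriv_boundary' (f := fun t => -y t) (f' := fun t => -y' t)
    (B := fun _ => -K) (B' := fun _ => 0) (a := a) (b := T)
    (fun t ht => (hy t ht).continuousWithinAt.neg)
    (fun t ht => ((hy t (Ico_subset_Icc_self ht)).Ici_of_Icc ht).fun_neg)
    (by simpa using ha) continuousOn_const
    (fun t _ => hasDerivWithinAt_const _ _ _)
    (fun t ht e => by
      have := h t (Ico_subset_Icc_self ht) (by simp at e; exact e.ge)
      linarith) ht
  simpa using this

/-- A solution of `y' ≥ c y ^ p` above the level `K` cannot exist for all times. -/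
theorem no_global_superlinear {K c p : ℝ} (hK : 0 < K) (hc : 0 < c) (hp : 1 < p)
    (hy : ∀ t ∈ Ici a, HasDerivWithinAt y (y' t) (Ici a) t)
    (h : ∀ t ∈ Ici a, K ≤ y t → c * y t ^ p ≤ y' t) (ha : K ≤ y a) : False := by
  have hKy : ∀ t ∈ Ici a, K ≤ y t := fun t ht =>
    le_of_deriv_pos_above (T := t) (fun s hs => (hy s hs.1).mono Icc_subset_Ici_self)
      (fun s hs hKs => (mul_pos hc (Real.rpow_pos_of_pos (hK.trans_le hKs) p)).trans_le
        (h s hs.1 hKs)) ha (right_mem_Icc.2 ht)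
  have hpos : ∀ t ∈ Ici a, 0 < y t := fun t ht => hK.trans_le (hKy t ht)
  have hz : ∀ t ∈ Ici a, y t ^ (1 - p) + (p - 1) * c * (t - a) ≤ y a ^ (1 - p) := by
    intro t ht
    have hmono := monotoneOn_Icc_of_hasDerivWithinAt (a := a) (T := t)
      (y := fun s => -(y s ^ (1 - p) + (p - 1) * c * (s - a)))
      (y' := fun s => -(y' s * (1 - p) * y s ^ (1 - p - 1) + (p - 1) * c * 1))
      (fun s hs => ((((hy s hs.1).mono Icc_subset_Ici_self).rpow_const
        (Or.inl (hpos s hs.1).ne')).fun_add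
        (((hasDerivAt_id s).sub_const a).const_mul ((p - 1) * c)).hasDerivWithinAt).fun_neg)
      (fun s hs => by
        have h1 := h s hs.1.le (hKy s hs.1.le)
        have h2 : y s ^ p * y s ^ (1 - p - 1) = 1 := by
          rw [← Real.rpow_add (hpos s hs.1.le)]; simp
        have h3 : 0 < y s ^ (1 - p - 1) := Real.rpow_pos_of_pos (hpos s hs.1.le) _
        have h4 : c ≤ y' s * y s ^ (1 - p - 1) := by
          calc c = c * y s ^ p * y s ^ (1 - p - 1) := by rw [mul_assoc, h2, mul_one]
            _ ≤ _ := by gcongr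
        nlinarith)
    have := hmono (left_mem_Icc.2 ht) (right_mem_Icc.2 ht) ht
    simp only [sub_self, mul_zero, add_zero] at this
    linarith
  have hpc : 0 < (p - 1) * c := mul_pos (by linarith) hc
  have h1 : 0 ≤ y a ^ (1 - p) / ((p - 1) * c) :=
    div_nonneg (Real.rpow_nonneg (hpos a self_mem_Ici).le _) hpc.le
  have h2 : a ≤ a + y a ^ (1 - p) / ((p - 1) * c) := by linarith
  have h3 := hz _ h2
  have h4 := Real.rpow_pos_of_pos (hpos _ h2) (1 - p)
  rw [add_sub_cancel_left, mul_div_cancel₀ _ hpc.ne'] at h3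
  linarith

/-- Comparison principle for quasi-monotone differential inequalities. -/
theorem le_of_quasimonotone {ι : Type*} [Fintype ι] {X Y X' Y' : ℝ → ι → ℝ} {L : ℝ} (hL : 0 ≤ L)
    (hX : ∀ t ∈ Icc a T, HasDerivWithinAt X (X' t) (Icc a T) t)
    (hY : ∀ t ∈ Icc a T, HasDerivWithinAt Y (Y' t) (Icc a T) t)
    (h : ∀ t ∈ Icc a T, ∀ i, Y t i < X t i →
      X' t i - Y' t i ≤ L * ∑ j, max (X t j - Y t j) 0)
    (h0 : X a ≤ Y a) {t : ℝ} (ht : t ∈ Icc a T) : X t ≤ Y t := by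
  have key := nonpos_of_deriv_le_mul (y := fun t => ∑ i, max (X t i - Y t i) 0 ^ 2)
    (y' := fun t => ∑ i, 2 * max (X t i - Y t i) 0 * (X' t i - Y' t i))
    (C := 2 * L * Fintype.card ι) (a := a) (T := T)
    (fun t ht => HasDerivWithinAt.fun_sum fun i _ =>
      (hasDerivAt_max_zero_sq (X t i - Y t i)).comp_hasDerivWithinAt t
        (((hasDerivWithinAt_pi.1 (hX t ht)) i).sub ((hasDerivWithinAt_pi.1 (hY t ht)) i)))
    (fun t ht => by
      set S := ∑ j, max (X t j - Y t j) 0 with hS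
      calc ∑ i, 2 * max (X t i - Y t i) 0 * (X' t i - Y' t i)
          ≤ ∑ i, 2 * max (X t i - Y t i) 0 * (L * S) := by
            refine Finset.sum_le_sum fun i _ => ?_
            rcases le_or_gt (X t i) (Y t i) with hi | hi
            · simp [max_eq_right (sub_nonpos.2 hi)]
            · exact mul_le_mul_of_nonneg_left (h t ht i hi) (by positivity)
        _ = 2 * L * S ^ 2 := by rw [← Finset.sum_mul, ← Finset.mul_sum]; ring
        _ ≤ 2 * L * (Fintype.card ι * ∑ i, max (X t i - Y t i) 0 ^ 2) := by
            gcongr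
            exact sq_sum_le_card_mul_sum_sq
        _ = _ := by ring)
    (by
      refine (Finset.sum_eq_zero fun i _ => ?_).le
      simp [max_eq_right (sub_nonpos.2 (h0 i))]) ht
  intro i
  have h1 : max (X t i - Y t i) 0 ^ 2 ≤ 0 :=
    (Finset.single_le_sum (f := fun i => max (X t i - Y t i) 0 ^ 2)
      (fun j _ => sq_nonneg _) (Finset.mem_univ i)).trans key
  have h2 : max (X t i - Y t i) 0 = 0 := by nlinarith [sq_nonneg (max (X t i - Y t i) 0)]
  linarith [le_max_left (X t i - Y t i) 0]

end ScalarInequalities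
section VectorField

variable {d : ℕ} {h p : ℝ}

theorem coordFn_val (u : Fin d → ℝ) (i : Fin d) : coordFn u (i : ℕ) = u i := by
  simp [coordFn]

theorem coordFn_of_lt (u : Fin d → ℝ) {n : ℕ} (hn : n < d) : coordFn u n = u ⟨n, hn⟩ := by
  simp [coordFn, hn]

theorem coordFn_nonneg {u : Fin d → ℝ} (hu : 0 ≤ u) (n : ℕ) : 0 ≤ coordFn u n := by
  unfold coordFn
  split_ifs
  · exact hu _
  · exact le_rfl

theorem coordFn_smul (c : ℝ) (u : Fin d → ℝ) (n : ℕ) : coordFn (c • u) n = c * coordFn u n := by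
  unfold coordFn
  split_ifs <;> simp

theorem coordFn_sub_le {u v : Fin d → ℝ} {P : ℝ} (hP : 0 ≤ P) (huv : ∀ i, u i - v i ≤ P) (n : ℕ) :
    coordFn u n - coordFn v n ≤ P := by
  unfold coordFn
  split_ifs
  · exact huv _
  · simpa

theorem abs_coordFn_sub_le (u v : Fin d → ℝ) (n : ℕ) :
    |coordFn u n - coordFn v n| ≤ ‖u - v‖ := by
  unfold coordFn
  split_ifs with hn
  · exact norm_le_pi_norm (u - v) ⟨n, hn⟩
  · simp

theorem abs_coordFn_le (u : Fin d → ℝ) (n : ℕ) : |coordFn u n| ≤ ‖u‖ := by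
  unfold coordFn
  split_ifs with hn
  · exact norm_le_pi_norm u ⟨n, hn⟩
  · simp

theorem exists_lipschitz_posPart_rpow (hp : 1 < p) (M : ℝ) : ∃ L, 0 ≤ L ∧
    ∀ x y, |x| ≤ M → |y| ≤ M → |max x 0 ^ p - max y 0 ^ p| ≤ L * |x - y| := by
  rcases lt_or_ge M 0 with hM | hM
  · exact ⟨0, le_rfl, fun x y hx _ => absurd ((abs_nonneg x).trans hx) (not_le.2 hM)⟩
  refine ⟨p * M ^ (p - 1), by positivity, fun x y hx hy => ?_⟩
  have hm : ∀ z, |z| ≤ M → max z 0 ∈ Icc 0 M := fun z hz =>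
    ⟨le_max_right _ _, max_le ((le_abs_self z).trans hz) hM⟩
  have h1 := Convex.norm_image_sub_le_of_norm_hasDerivWithin_le (f := fun x : ℝ => x ^ p)
    (f' := fun x => p * x ^ (p - 1)) (s := Icc 0 M) (C := p * M ^ (p - 1))
    (fun z _ => (Real.hasDerivAt_rpow_const (Or.inr hp.le)).hasDerivWithinAt)
    (fun z hz => by
      rw [Real.norm_eq_abs, abs_of_nonneg
        (mul_nonneg (by linarith) (Real.rpow_nonneg hz.1 _))]
      exact mul_le_mul_of_nonneg_left (Real.rpow_le_rpow hz.1 hz.2 (by linarith)) (by linarith))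
    (convex_Icc 0 M) (hm y hy) (hm x hx)
  refine h1.trans ?_
  gcongr
  exact abs_max_sub_max_le_abs x y 0

theorem bField_eq (u : Fin d → ℝ) (i : Fin d) : bField d h p u i = 1 / h ^ 2 *
    (if (i : ℕ) = 0 then 2 * (-coordFn u 0 + coordFn u 1)
      else if (i : ℕ) = d - 1 then 2 * (-coordFn u (d - 1) + coordFn u (d - 2)
        + h * (max (coordFn u (d - 1)) 0 ^ p - coordFn u (d - 1)))
      else coordFn u (i + 1) - 2 * coordFn u i + coordFn u (i - 1)) := by
  unfold bField
  split_ifs <;> ring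

/-- The one-sided Lipschitz estimate behind the comparison principle: `bField` is cooperative. -/
theorem bField_sub_le (hh : 0 < h) (hp : 1 < p) (M : ℝ) : ∃ L, 0 ≤ L ∧
    ∀ u v : Fin d → ℝ, ‖u‖ ≤ M → ‖v‖ ≤ M → ∀ i, v i < u i →
      bField d h p u i - bField d h p v i ≤ L * ∑ j, max (u j - v j) 0 := by
  obtain ⟨L, hL, hLip⟩ := exists_lipschitz_posPart_rpow hp M
  refine ⟨1 / h ^ 2 * (2 * (1 + h * L)), by positivity, fun u v hu hv i hi => ?_⟩
  set P := ∑ j, max (u j - v j) 0 with hPdef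
  have hP : 0 ≤ P := Finset.sum_nonneg fun j _ => le_max_right _ _
  have hle : ∀ j, u j - v j ≤ P := fun j => (le_max_left _ _).trans
    (Finset.single_le_sum (f := fun j => max (u j - v j) 0)
      (fun j _ => le_max_right _ _) (Finset.mem_univ j))
  have hc := coordFn_sub_le hP hle
  rw [← coordFn_val u i, ← coordFn_val v i] at hi
  have hk : 0 < 1 / h ^ 2 := by positivity
  have hhL : 0 ≤ h * L * P := by positivity
  rw [bField_eq, bField_eq, ← mul_sub, mul_assoc]
  refine mul_le_mul_of_nonneg_left ?_ hk.le
  split_ifs with h0 h1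
  · rw [h0] at hi
    have := hc 1
    linarith
  · rw [h1] at hi
    have h2 := hc (d - 2)
    have h3 := hLip _ _ ((abs_coordFn_le u (d - 1)).trans hu) ((abs_coordFn_le v (d - 1)).trans hv)
    have h4 := (le_abs_self _).trans h3
    rw [abs_of_pos (sub_pos.2 hi)] at h4
    have h5 : max (coordFn u (d - 1)) 0 ^ p - max (coordFn v (d - 1)) 0 ^ p ≤ L * P :=
      h4.trans (mul_le_mul_of_nonneg_left (hc _) hL)
    have h6 := mul_le_mul_of_nonneg_left h5 hh.le
    have h7 := mul_pos hh (sub_pos.2 hi)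
    linarith
  · have h2 := hc (i + 1)
    have h3 := hc (i - 1)
    linarith

theorem abs_bField_sub_le (hh : 0 < h) (hp : 1 < p) (M : ℝ) : ∃ L, 0 ≤ L ∧
    ∀ u v : Fin d → ℝ, ‖u‖ ≤ M → ‖v‖ ≤ M → ∀ i,
      |bField d h p u i - bField d h p v i| ≤ L * ‖u - v‖ := by
  obtain ⟨L, hL, hLip⟩ := exists_lipschitz_posPart_rpow hp M
  refine ⟨1 / h ^ 2 * (2 * (2 + h * (L + 1))), by positivity, fun u v hu hv i => ?_⟩
  have hc := fun n => abs_le.1 (abs_coordFn_sub_le u v n)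
  set P := ‖u - v‖ with hPdef
  have hP : 0 ≤ P := norm_nonneg _
  have hk : 0 < 1 / h ^ 2 := by positivity
  have hhL : 0 ≤ h * L * P := by positivity
  have hhP : 0 ≤ h * P := by positivity
  rw [bField_eq, bField_eq, ← mul_sub, mul_assoc, abs_mul, abs_of_pos hk]
  refine mul_le_mul_of_nonneg_left (abs_le.2 ?_) hk.le
  split_ifs with h0 h1
  · have h2 := hc 1
    have h3 := hc 0
    constructor <;> linarith [h2.1, h2.2, h3.1, h3.2]
  · have h2 := hc (d - 2)
    have h3 := hc (d - 1)
    have h4 := hLip _ _ ((abs_coordFn_le u (d - 1)).trans hu) ((abs_coordFn_le v (d - 1)).trans hv)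
    have h5 := abs_le.1 (h4.trans (mul_le_mul_of_nonneg_left (abs_le.2 h3) hL))
    have h6 := mul_le_mul_of_nonneg_left h5.1 hh.le
    have h7 := mul_le_mul_of_nonneg_left h5.2 hh.le
    have h8 := mul_le_mul_of_nonneg_left h3.1 hh.le
    have h9 := mul_le_mul_of_nonneg_left h3.2 hh.le
    constructor <;> linarith [h2.1, h2.2, h3.1, h3.2]
  · have h2 := hc (i + 1)
    have h3 := hc (i - 1)
    have h4 := hc i
    constructor <;> linarith [h2.1, h2.2, h3.1, h3.2, h4.1, h4.2]

theorem bField_zero (hp : 1 < p) : bField d h p 0 = 0 := by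
  have hp0 : p ≠ 0 := by linarith
  have h0 : ∀ n, coordFn (0 : Fin d → ℝ) n = 0 := fun n => by simp [coordFn]
  ext i
  simp [bField, h0, Real.zero_rpow hp0]

theorem locallyTame_bField (hh : 0 < h) (hp : 1 < p) : LocallyTame (bField d h p) := by
  intro M
  set R := max M 0 with hR
  have hR0 : 0 ≤ R := le_max_right _ _
  obtain ⟨L, hL, hLip⟩ := abs_bField_sub_le (d := d) hh hp R
  set c : (Fin d → ℝ) → (Fin d → ℝ) := fun u i => max (-R) (min R (u i)) with hc
  have hcR : ∀ u, ‖c u‖ ≤ R := fun u => (pi_norm_le_iff_of_nonneg hR0).2 fun i =>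
    abs_le.2 ⟨le_max_left _ _, max_le (by linarith) (min_le_left _ _)⟩
  have hcL : ∀ u v, ‖c u - c v‖ ≤ ‖u - v‖ := fun u v =>
    (pi_norm_le_iff_of_nonneg (norm_nonneg _)).2 fun i => by
      have h1 := abs_max_sub_max_le_abs (min R (u i)) (min R (v i)) (-R)
      have h2 := abs_min_sub_min_le_max R (u i) R (v i)
      rw [sub_self, abs_zero, max_eq_right (abs_nonneg _)] at h2
      rw [max_comm, max_comm (min R (v i))] at h1
      exact (h1.trans h2).trans (norm_le_pi_norm (u - v) i)
  have hbc : ∀ u v, ‖bField d h p (c u) - bField d h p (c v)‖ ≤ L * ‖c u - c v‖ := fun u v =>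
    (pi_norm_le_iff_of_nonneg (by positivity)).2 fun i => hLip _ _ (hcR u) (hcR v) i
  refine ⟨fun u => bField d h p (c u), L.toNNReal, (L * R).toNNReal,
    LipschitzWith.of_dist_le_mul fun u v => ?_, fun u => ?_, fun u hu => ?_⟩
  · rw [dist_eq_norm, dist_eq_norm, Real.coe_toNNReal _ hL]
    exact (hbc u v).trans (mul_le_mul_of_nonneg_left (hcL u v) hL)
  · rw [Real.coe_toNNReal _ (by positivity)]
    have h0 : c 0 = 0 := by
      ext i
      simp [hc, hR0]
    have := hbc u 0
    rw [h0, bField_zero hp, sub_zero, sub_zero] at this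
    exact this.trans (mul_le_mul_of_nonneg_left (hcR u) hL)
  · have : c u = u := by
      ext i
      have h1 := abs_le.1 ((norm_le_pi_norm u i).trans (hu.trans (le_max_left M 0)))
      simp only [hc]
      rw [min_eq_right h1.2, max_eq_right h1.1]
    simp only [this]

theorem bField_const (hd : 2 ≤ d) (c : ℝ) (i : Fin d) :
    bField d h p (fun _ => c) i =
      if (i : ℕ) = d - 1 then 2 / h ^ 2 * (h * (max c 0 ^ p - c)) else 0 := by
  have hi := i.2
  have hc : ∀ n < d, coordFn (fun _ : Fin d => c) n = c := fun n hn => by simp [coordFn, hn]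
  unfold bField
  rw [hc (d - 1) (by omega), hc (d - 2) (by omega), hc 0 (by omega), hc 1 (by omega), hc i hi]
  split_ifs with h0 h1 h1
  · omega
  · ring
  · ring
  · rw [hc (i + 1) (by omega), hc (i - 1) (by omega)]
    ring

theorem bField_const_nonpos (hd : 2 ≤ d) (hh : 0 < h) (hp : 1 < p) {c : ℝ} (hc0 : 0 ≤ c)
    (hc1 : c ≤ 1) (i : Fin d) : bField d h p (fun _ => c) i ≤ 0 := by
  rw [bField_const hd, max_eq_left hc0]
  split_ifs
  · have : c ^ p ≤ c := by
      simpa using Real.rpow_le_rpow_of_exponent_ge' hc0 hc1 zero_le_one hp.le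
    have h2 : h * (c ^ p - c) ≤ 0 := mul_nonpos_of_nonneg_of_nonpos hh.le (by linarith)
    exact mul_nonpos_of_nonneg_of_nonpos (by positivity) h2
  · exact le_rfl

theorem bField_const_one (hd : 2 ≤ d) (i : Fin d) : bField d h p (fun _ => 1) i = 0 := by
  simp [bField_const hd]

theorem smul_bField_le (hh : 0 < h) (hp : 1 < p) {u : Fin d → ℝ} {μ : ℝ} (hμ : 1 ≤ μ)
    (i : Fin d) : μ * bField d h p u i ≤ bField d h p (μ • u) i := by
  unfold bField
  simp only [coordFn_smul]
  split_ifs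
  · exact le_of_eq (by ring)
  · have hx : max (μ * coordFn u (d - 1)) 0 = μ * max (coordFn u (d - 1)) 0 := by
      rw [mul_max_of_nonneg _ _ (by linarith), mul_zero]
    rw [hx, Real.mul_rpow (by linarith) (le_max_right _ _)]
    have h1 : μ ≤ μ ^ p := by simpa using Real.rpow_le_rpow_of_exponent_le hμ hp.le
    have h2 : 0 ≤ max (coordFn u (d - 1)) 0 ^ p := Real.rpow_nonneg (le_max_right _ _) _
    have h3 := mul_le_mul_of_nonneg_left (mul_le_mul_of_nonneg_right h1 h2) hh.le
    rw [mul_left_comm]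
    refine mul_le_mul_of_nonneg_left ?_ (by positivity)
    linarith
  · exact le_of_eq (by ring)

theorem bField_ge (hh : 0 < h) {u : Fin d → ℝ} (hu : 0 ≤ u) (i j : Fin d)
    (hij : (j : ℕ) = i + 1 ∨ (i : ℕ) = j + 1) :
    -(2 / h ^ 2 * (1 + h)) * u i + 1 / h ^ 2 * u j ≤ bField d h p u i := by
  have hk : 0 < 1 / h ^ 2 := by positivity
  have hi := i.2
  have hj := j.2
  have hn := coordFn_nonneg hu
  have hpow : 0 ≤ h * max (coordFn u (d - 1)) 0 ^ p :=
    mul_nonneg hh.le (Real.rpow_nonneg (le_max_right _ _) _)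
  have hhn := fun n => mul_nonneg hh.le (hn n)
  have e : -(2 / h ^ 2 * (1 + h)) * u i + 1 / h ^ 2 * u j =
      1 / h ^ 2 * (-((1 + h) * 2 * u i) + u j) := by ring
  rw [e, bField_eq, ← coordFn_val u i, ← coordFn_val u j]
  refine mul_le_mul_of_nonneg_left ?_ hk.le
  split_ifs with h0 h1
  · have : (j : ℕ) = 1 := by omega
    rw [this, h0]
    linarith [hhn 0, hn 0, hn 1]
  · have : (j : ℕ) = d - 2 := by omega
    rw [this, h1]
    linarith [hhn (d - 1), hn (d - 1), hn (d - 2)]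
  · rcases hij with hij | hij
    · rw [hij]
      linarith [hhn i, hn i, hn (i + 1), hn (i - 1)]
    · have : (j : ℕ) = i - 1 := by omega
      rw [this]
      linarith [hhn i, hn i, hn (i + 1), hn (i - 1)]

end VectorField

/-- The index of the last coordinate, the one carrying the nonlinearity. -/
def lastIdx {d : ℕ} (hd : 2 ≤ d) : Fin d := ⟨d - 1, by omega⟩

section Comparison

variable {d : ℕ} {h p a T : ℝ} {U V : ℝ → Fin d → ℝ}

theorem IsIntegralCurveOn.hasDerivWithinAt_apply {s : Set ℝ} {b : (Fin d → ℝ) → Fin d → ℝ}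
    (hU : IsIntegralCurveOn U (fun _ => b) s) {t : ℝ} (ht : t ∈ s)
    (i : Fin d) : HasDerivWithinAt (fun t => U t i) (b (U t) i) s t :=
  hasDerivWithinAt_pi.1 (hU t ht) i

theorem le_of_bField_sub_le (hh : 0 < h) (hp : 1 < p) {X Y X' Y' : ℝ → Fin d → ℝ}
    (hX : ∀ t ∈ Icc a T, HasDerivWithinAt X (X' t) (Icc a T) t)
    (hY : ∀ t ∈ Icc a T, HasDerivWithinAt Y (Y' t) (Icc a T) t)
    (H : ∀ t ∈ Icc a T, ∀ i, Y t i < X t i →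
      X' t i - Y' t i ≤ bField d h p (X t) i - bField d h p (Y t) i)
    (h0 : X a ≤ Y a) {t : ℝ} (ht : t ∈ Icc a T) : X t ≤ Y t := by
  obtain ⟨M, hM⟩ := isCompact_Icc.exists_bound_of_continuousOn
    (fun t ht => (hX t ht).continuousWithinAt : ContinuousOn X (Icc a T))
  obtain ⟨N, hN⟩ := isCompact_Icc.exists_bound_of_continuousOn
    (fun t ht => (hY t ht).continuousWithinAt : ContinuousOn Y (Icc a T))
  obtain ⟨L, hL, hb⟩ := bField_sub_le (d := d) hh hp (max M N)
  exact le_of_quasimonotone hL hX hY (fun t ht i hi => (H t ht i hi).trans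
    (hb _ _ ((hM t ht).trans (le_max_left _ _)) ((hN t ht).trans (le_max_right _ _)) i hi)) h0 ht

theorem nonneg_of_nonneg_initial (hh : 0 < h) (hp : 1 < p)
    (hU : IsIntegralCurveOn U (fun _ => bField d h p) (Icc a T)) (h0 : 0 ≤ U a) {t : ℝ}
    (ht : t ∈ Icc a T) : 0 ≤ U t :=
  le_of_bField_sub_le hh hp (X := fun _ => 0) (fun _ _ => hasDerivWithinAt_const _ _ 0) hU
    (fun t _ i _ => by rw [bField_zero hp]) h0 ht

theorem le_const_of_last_le (hd : 2 ≤ d) (hh : 0 < h) (hp : 1 < p) {R : ℝ}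
    (hU : IsIntegralCurveOn U (fun _ => bField d h p) (Icc a T)) (h0 : U a ≤ fun _ => R)
    (hR : ∀ t ∈ Icc a T, U t (lastIdx hd) ≤ R) {t : ℝ} (ht : t ∈ Icc a T) :
    U t ≤ fun _ => R := by
  refine le_of_bField_sub_le hh hp (Y := fun _ _ => R) (Y' := fun _ => 0) hU
    (fun _ _ => hasDerivWithinAt_const _ _ _) (fun t ht i hi => ?_) h0 ht
  by_cases hiL : i = lastIdx hd
  · rw [hiL] at hi
    exact absurd (hR t ht) (not_le.2 hi)
  · rw [bField_const hd, if_neg (show ¬(i : ℕ) = d - 1 from fun e => hiL (Fin.ext e))]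
    rfl

theorem le_const_of_le_one (hd : 2 ≤ d) (hh : 0 < h) (hp : 1 < p) {c : ℝ} (hc0 : 0 ≤ c)
    (hc1 : c ≤ 1) (hU : IsIntegralCurveOn U (fun _ => bField d h p) (Icc a T))
    (h0 : U a ≤ fun _ => c) {t : ℝ} (ht : t ∈ Icc a T) : U t ≤ fun _ => c :=
  le_of_bField_sub_le hh hp (Y := fun _ _ => c) (Y' := fun _ => 0) hU
    (fun _ _ => hasDerivWithinAt_const _ _ _) (fun t _ i _ => by
      have := bField_const_nonpos hd hh hp hc0 hc1 i
      simp only [Pi.zero_apply]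
      linarith) h0 ht

theorem one_le_of_one_le_initial (hd : 2 ≤ d) (hh : 0 < h) (hp : 1 < p)
    (hU : IsIntegralCurveOn U (fun _ => bField d h p) (Icc a T))
    (h0 : (fun _ => 1) ≤ U a) {t : ℝ} (ht : t ∈ Icc a T) : (fun _ => 1) ≤ U t :=
  le_of_bField_sub_le hh hp (X := fun _ _ => 1) (X' := fun _ => 0)
    (fun _ _ => hasDerivWithinAt_const _ _ _) hU (fun t _ i _ => by
      rw [bField_const_one hd]
      rfl) h0 ht

theorem smul_le_of_smul_initial_le (hh : 0 < h) (hp : 1 < p) {μ : ℝ} (hμ : 1 ≤ μ)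
    (hU : IsIntegralCurveOn U (fun _ => bField d h p) (Icc a T))
    (hV : IsIntegralCurveOn V (fun _ => bField d h p) (Icc a T))
    (h0 : μ • U a ≤ V a) {t : ℝ} (ht : t ∈ Icc a T) : μ • U t ≤ V t :=
  le_of_bField_sub_le hh hp (X := fun t => μ • U t)
    (fun t ht => (hU t ht).fun_const_smul μ) hV (fun t _ i _ => by
      have := smul_bField_le hh hp hμ (u := U t) i
      simp only [Pi.smul_apply, smul_eq_mul]
      linarith) h0 ht

theorem pos_of_nonneg_of_ne_zero (hd : 2 ≤ d) (hh : 0 < h) (hp : 1 < p) {T : ℝ} (hT : 0 < T)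
    (hU : IsIntegralCurveOn U (fun _ => bField d h p) (Icc 0 T)) (h0 : 0 ≤ U 0) (hne : U 0 ≠ 0)
    (i : Fin d) : 0 < U T i := by
  obtain ⟨j, hj⟩ : ∃ j, 0 < U 0 j := by
    by_contra! H
    exact hne (le_antisymm H h0)
  have hpos := fun t ht => nonneg_of_nonneg_initial hh hp hU h0 (t := t) ht
  have hder := fun i t (ht : t ∈ Icc 0 T) => hU.hasDerivWithinAt_apply ht i
  have hk : 0 < 1 / h ^ 2 := by positivity
  have base : ∀ t ∈ Ioc 0 T, 0 < U t j := by
    have hlow : ∀ t ∈ Ioo 0 T, -(2 / h ^ 2 * (1 + h)) * U t j ≤ bField d h p (U t) j := by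
      intro t ht
      have ht' := hpos t (Ioo_subset_Icc_self ht)
      have hjd := j.2
      by_cases h1 : (j : ℕ) + 1 < d
      · have := bField_ge (p := p) hh ht' j ⟨j + 1, h1⟩ (Or.inl rfl)
        nlinarith [mul_nonneg hk.le (ht' ⟨j + 1, h1⟩)]
      · have := bField_ge (p := p) hh ht' j ⟨j - 1, by omega⟩ (Or.inr (by simp; omega))
        nlinarith [mul_nonneg hk.le (ht' ⟨j - 1, by omega⟩)]
    exact fun t ht => pos_of_deriv_ge (hder j) hlow hj (Ioc_subset_Icc_self ht)
  have step : ∀ i k : Fin d, ((k : ℕ) = i + 1 ∨ (i : ℕ) = k + 1) →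
      (∀ t ∈ Ioc 0 T, 0 < U t k) → ∀ t ∈ Ioc 0 T, 0 < U t i := fun i k hik hk' t ht =>
    pos_of_deriv_gt (hder i) (C := 2 / h ^ 2 * (1 + h)) (fun s hs => by
      have := bField_ge (p := p) hh (hpos s (Ioo_subset_Icc_self hs)) i k hik
      have h2 := mul_pos hk (hk' s (Ioo_subset_Ioc_self hs))
      linarith) (h0 i) ht
  have up : ∀ n (hn : j + n < d), ∀ t ∈ Ioc 0 T, 0 < U t ⟨j + n, hn⟩ := by
    intro n
    induction n with
    | zero => exact fun _ => base
    | succ n ih => exact fun hn => step _ ⟨j + n, by omega⟩ (Or.inr rfl) (ih (by omega))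
  have down : ∀ n (hn : (j : ℕ) - n < d), ∀ t ∈ Ioc 0 T, 0 < U t ⟨j - n, hn⟩ := by
    intro n
    induction n with
    | zero => exact fun _ => base
    | succ n ih =>
      intro hn
      by_cases hjn : n < j
      · exact step _ ⟨j - n, by omega⟩ (Or.inl (by simp; omega)) (ih (by omega))
      · have : (⟨j - (n + 1), hn⟩ : Fin d) = ⟨j - n, by omega⟩ := Fin.ext (by simp; omega)
        rw [this]
        exact ih (by omega)
  rcases le_total (j : ℕ) i with hji | hji
  · have := up (i - j) (by omega) T ⟨hT, le_rfl⟩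
    rwa [show (⟨j + (i - j), by omega⟩ : Fin d) = i from Fin.ext (by simp; omega)] at this
  · have := down (j - i) (by omega) T ⟨hT, le_rfl⟩
    rwa [show (⟨j - (j - i), by omega⟩ : Fin d) = i from Fin.ext (by simp; omega)] at this

end Comparison

/-- A form of Barbalat's lemma: a Lipschitz function which is square-dominated by the dissipation of
an energy bounded from below tends to zero. -/
theorem tendsto_zero_of_dissipation {e e' f : ℝ → ℝ} {B L : ℝ}
    (he : ∀ t ∈ Ici (0 : ℝ), HasDerivWithinAt e (e' t) (Ici 0) t)
    (hf : ∀ t ∈ Ici (0 : ℝ), e' t ≤ -(f t ^ 2 / 2)) (hB : ∀ t ∈ Ici (0 : ℝ), B ≤ e t)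
    (hL : 0 ≤ L)
    (hLip : ∀ s ∈ Ici (0 : ℝ), ∀ t ∈ Ici (0 : ℝ), |f t - f s| ≤ L * |t - s|) :
    Tendsto f atTop (𝓝 0) := by
  have drop : ∀ s t r : ℝ, 0 ≤ s → s ≤ t → (∀ x ∈ Icc s t, r ≤ f x ^ 2 / 2) →
      e t ≤ e s - r * (t - s) := by
    intro s t r hs hst hr
    have := monotoneOn_Icc_of_hasDerivWithinAt (a := s) (T := t) (y := fun x => -e x - r * (x - s))
      (y' := fun x => -e' x - r)
      (fun x hx => by
        have h1 := (he x (hs.trans hx.1)).mono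
          (fun z hz => hs.trans hz.1 : Icc s t ⊆ Ici 0)
        have h2 : HasDerivWithinAt (fun x => r * (x - s)) r (Icc s t) x := by
          simpa using (((hasDerivAt_id x).sub_const s).const_mul r).hasDerivWithinAt
        exact h1.fun_neg.sub h2)
      (fun x hx => by
        have h1 := hf x (hs.trans hx.1.le)
        have h2 := hr x (Ioo_subset_Icc_self hx)
        linarith)
      (left_mem_Icc.2 hst) (right_mem_Icc.2 hst) hst
    simp only [sub_self, mul_zero] at this
    linarith
  rw [Metric.tendsto_atTop]
  by_contra! H
  obtain ⟨ε, hε, H⟩ := H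
  set δ := ε / (2 * (L + 1)) with hδ
  have hδ0 : 0 < δ := by positivity
  have hLδ : L * δ ≤ ε / 2 := by
    rw [hδ, mul_div_assoc', div_le_div_iff₀ (by positivity) (by norm_num)]
    nlinarith
  set S := e '' Ici 0 with hS
  have hSne : S.Nonempty := ⟨e 0, 0, self_mem_Ici, rfl⟩
  have hSb : BddBelow S := ⟨B, by rintro _ ⟨t, ht, rfl⟩; exact hB t ht⟩
  obtain ⟨_, ⟨t₀, ht₀, rfl⟩, hlt⟩ := exists_lt_of_csInf_lt hSne
    (lt_add_of_pos_right (sInf S) (show 0 < ε ^ 2 / 8 * δ by positivity))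
  obtain ⟨t, ht, hft⟩ := H t₀
  have ht0 : 0 ≤ t := le_trans ht₀ ht
  rw [Real.dist_0_eq_abs] at hft
  have h1 := drop t₀ t 0 ht₀ ht fun x _ => by positivity
  have h2 := drop t (t + δ) (ε ^ 2 / 8) ht0 (by linarith) fun x hx => by
    have h3 := hLip t ht0 x (ht0.trans hx.1)
    have h4 : L * |x - t| ≤ L * δ := by
      rw [abs_of_nonneg (by linarith [hx.1])]
      exact mul_le_mul_of_nonneg_left (by linarith [hx.2]) hL
    have h5 : |f t| - |f x| ≤ |f x - f t| := by
      rw [abs_sub_comm]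
      exact abs_sub_abs_le_abs_sub _ _
    have h6 : ε / 2 ≤ |f x| := by linarith
    have h7 : (ε / 2) ^ 2 ≤ |f x| ^ 2 := pow_le_pow_left₀ (by positivity) h6 2
    rw [sq_abs] at h7
    linarith
  have h3 : sInf S ≤ e (t + δ) := csInf_le hSb ⟨t + δ, by simp; linarith, rfl⟩
  have h4 : t + δ - t = δ := by ring
  rw [h4] at h2
  linarith

theorem tendsto_zero_or_one_of_rpow_sub_self {y : ℝ → ℝ} {p : ℝ} (hp : 1 < p)
    (hy : ContinuousOn y (Ici 0)) (hy0 : ∀ t ∈ Ici (0 : ℝ), 0 ≤ y t)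
    (hg : Tendsto (fun t => y t ^ p - y t) atTop (𝓝 0)) :
    Tendsto y atTop (𝓝 0) ∨ Tendsto y atTop (𝓝 1) := by
  have hq : 0 < p - 1 := by linarith
  have hfac : ∀ x : ℝ, 0 < x → x ^ p - x = x * (x ^ (p - 1) - 1) := fun x hx => by
    rw [mul_sub, mul_one, Real.rpow_sub_one hx.ne', mul_div_cancel₀ _ hx.ne']
  have hhalf : (1 / 2 : ℝ) ^ (p - 1) < 1 := Real.rpow_lt_one (by norm_num) (by norm_num) hq
  obtain ⟨T, hT⟩ := Metric.tendsto_atTop.1 hg (1 / 2 * (1 - (1 / 2 : ℝ) ^ (p - 1)))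
    (by linarith)
  set T' := max T 0
  have hne : ∀ t ∈ Ici T', y t ≠ 1 / 2 := fun t ht e => by
    have := hT t ((le_max_left _ _).trans ht)
    rw [Real.dist_0_eq_abs, e, hfac _ (by norm_num), abs_mul, abs_sub_comm,
      abs_of_pos (by norm_num : (0 : ℝ) < 1 / 2), abs_of_pos (by linarith)] at this
    exact lt_irrefl _ this
  have hcont : ContinuousOn y (Ici T') := hy.mono (Ici_subset_Ici.2 (le_max_right _ _))
  have hdich : (∀ t ∈ Ici T', y t < 1 / 2) ∨ ∀ t ∈ Ici T', 1 / 2 < y t := by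
    by_contra! H
    obtain ⟨⟨s, hs, hs'⟩, t, ht, ht'⟩ := H
    obtain ⟨z, hz, hz'⟩ := isPreconnected_Ici.intermediate_value ht hs hcont
      (⟨ht', hs'⟩ : (1 / 2 : ℝ) ∈ Icc (y t) (y s))
    exact hne z hz hz'
  have habs : Tendsto (fun t => |y t ^ p - y t|) atTop (𝓝 0) := by simpa using hg.abs
  rcases hdich with hlow | hhigh
  · left
    refine squeeze_zero' (g := fun t => |y t ^ p - y t| / (1 - (1 / 2 : ℝ) ^ (p - 1))) ?_ ?_ ?_
    · filter_upwards [eventually_ge_atTop 0] with t ht using hy0 t ht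
    · filter_upwards [eventually_ge_atTop T'] with t ht
      rw [le_div_iff₀ (by linarith)]
      rcases (hy0 t ((le_max_right _ _).trans ht)).eq_or_lt with e | hpos
      · rw [← e, zero_mul]
        exact abs_nonneg _
      · have h1 : y t ^ (p - 1) ≤ (1 / 2) ^ (p - 1) :=
          Real.rpow_le_rpow hpos.le (hlow t ht).le hq.le
        rw [hfac _ hpos, abs_mul, abs_of_pos hpos, abs_sub_comm]
        exact mul_le_mul_of_nonneg_left (by linarith [le_abs_self (1 - y t ^ (p - 1))]) hpos.le
    · simpa using habs.div_const _
  · right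
    have hpow : Tendsto (fun t => y t ^ (p - 1)) atTop (𝓝 1) := by
      rw [tendsto_iff_dist_tendsto_zero]
      refine squeeze_zero' (g := fun t => 2 * |y t ^ p - y t|)
        (Eventually.of_forall fun _ => dist_nonneg) ?_ (by simpa using habs.const_mul 2)
      filter_upwards [eventually_ge_atTop T'] with t ht
      have h1 := hhigh t ht
      rw [hfac _ (by linarith), abs_mul, abs_of_pos (by linarith), Real.dist_eq]
      nlinarith [abs_nonneg (y t ^ (p - 1) - 1)]
    have h2 := hpow.rpow_const (p := 1 / (p - 1)) (Or.inl one_ne_zero)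
    rw [Real.one_rpow] at h2
    refine h2.congr' ?_
    filter_upwards [eventually_ge_atTop 0] with t ht
    rw [← Real.rpow_mul (hy0 t ht), mul_one_div_cancel hq.ne', Real.rpow_one]

theorem sum_mul_sub_eq_of_laplacian {x β : ℕ → ℝ} {r : ℝ} {m : ℕ}
    (h0 : r * β 0 = 2 * (x 1 - x 0))
    (hmid : ∀ n < m, r * β (n + 1) = x (n + 2) - 2 * x (n + 1) + x n) :
    ∑ n ∈ Finset.range (m + 1), (x (n + 1) - x n) * (β (n + 1) - β n) =
      (x (m + 1) - x m) * β (m + 1) -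
        r * (β 0 ^ 2 / 2 + ∑ n ∈ Finset.range m, β (n + 1) ^ 2) := by
  induction m with
  | zero =>
    simp only [zero_add, Finset.range_one, Finset.sum_singleton, Finset.range_zero,
      Finset.sum_empty, add_zero]
    linear_combination (β 0 / 2) * h0
  | succ m ih =>
    rw [Finset.sum_range_succ, ih fun n hn => hmid n (by omega), Finset.sum_range_succ _ m]
    linear_combination β (m + 1) * hmid m (by omega)

theorem sum_mul_sub_sub_le_of_laplacian {x β : ℕ → ℝ} {r G : ℝ} {m : ℕ} (hr : 0 ≤ r)
    (h0 : r * β 0 = 2 * (x 1 - x 0))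
    (hmid : ∀ n < m, r * β (n + 1) = x (n + 2) - 2 * x (n + 1) + x n)
    (hlast : r * β (m + 1) = 2 * (-x (m + 1) + x m + G)) {i : ℕ} (hi : i < m + 2) :
    ∑ n ∈ Finset.range (m + 1), (x (n + 1) - x n) * (β (n + 1) - β n) - G * β (m + 1) ≤
      -(r * (β i ^ 2 / 2)) := by
  have key : β i ^ 2 / 2 ≤
      β 0 ^ 2 / 2 + ∑ n ∈ Finset.range m, β (n + 1) ^ 2 + β (m + 1) ^ 2 / 2 := by
    have hs : 0 ≤ ∑ n ∈ Finset.range m, β (n + 1) ^ 2 := Finset.sum_nonneg fun _ _ => sq_nonneg _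
    have h1 := sq_nonneg (β 0)
    have h2 := sq_nonneg (β (m + 1))
    rcases i with _ | i
    · linarith
    · rcases Nat.lt_or_ge i m with him | him
      · have := Finset.single_le_sum (f := fun n => β (n + 1) ^ 2) (fun _ _ => sq_nonneg _)
          (Finset.mem_range.2 him)
        have h3 := sq_nonneg (β (i + 1))
        linarith
      · obtain rfl : i = m := by omega
        linarith
  rw [sum_mul_sub_eq_of_laplacian h0 hmid]
  have := mul_le_mul_of_nonneg_left key hr
  have h3 : (x (m + 1) - x m) * β (m + 1) - G * β (m + 1) = -(r * (β (m + 1) ^ 2 / 2)) := by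
    linear_combination (β (m + 1) / 2) * hlast
  linarith

section Convergence

variable {d : ℕ} {h p R : ℝ} {U : ℝ → Fin d → ℝ}

/-- The Lyapunov functional of the system, on nonnegative vectors. -/
noncomputable def energy (h p : ℝ) (u : Fin d → ℝ) : ℝ :=
  1 / (2 * h ^ 2) * ∑ n ∈ Finset.range (d - 1), (coordFn u (n + 1) - coordFn u n) ^ 2 -
    1 / h * (coordFn u (d - 1) ^ (p + 1) / (p + 1) - coordFn u (d - 1) ^ 2 / 2)

theorem hasDerivWithinAt_coordFn {s : Set ℝ} {v : Fin d → ℝ} {t : ℝ}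
    (hU : HasDerivWithinAt U v s t) (n : ℕ) :
    HasDerivWithinAt (fun t => coordFn (U t) n) (coordFn v n) s t := by
  unfold coordFn
  split_ifs with hn
  · exact hasDerivWithinAt_pi.1 hU ⟨n, hn⟩
  · exact hasDerivWithinAt_const _ _ _

theorem hasDerivWithinAt_energy (hp : 1 < p) {s : Set ℝ} {v : Fin d → ℝ} {t : ℝ}
    (hU : HasDerivWithinAt U v s t) :
    HasDerivWithinAt (fun t => energy h p (U t))
      (1 / h ^ 2 * ∑ n ∈ Finset.range (d - 1),
        (coordFn (U t) (n + 1) - coordFn (U t) n) * (coordFn v (n + 1) - coordFn v n) -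
        1 / h * ((coordFn (U t) (d - 1) ^ p - coordFn (U t) (d - 1)) * coordFn v (d - 1))) s t := by
  have hc := hasDerivWithinAt_coordFn hU
  have h1 : HasDerivWithinAt
      (fun t => ∑ n ∈ Finset.range (d - 1), (coordFn (U t) (n + 1) - coordFn (U t) n) ^ 2)
      (∑ n ∈ Finset.range (d - 1), 2 * ((coordFn (U t) (n + 1) - coordFn (U t) n) *
        (coordFn v (n + 1) - coordFn v n))) s t :=
    HasDerivWithinAt.fun_sum fun n _ =>
      (((hc (n + 1)).sub (hc n)).fun_pow 2).congr_deriv (by simp; ring)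
  have h2 := ((hc (d - 1)).rpow_const (p := p + 1) (Or.inr (by linarith))).div_const (p + 1)
  have h3 := ((hc (d - 1)).fun_pow 2).div_const 2
  refine ((h1.const_mul (1 / (2 * h ^ 2))).sub ((h2.sub h3).const_mul (1 / h))).congr_deriv ?_
  rw [← Finset.mul_sum]
  have hp1 : p + 1 ≠ 0 := by linarith
  rw [add_sub_cancel_right]
  field_simp
  simp
  ring

theorem energy_deriv_le (hd : 2 ≤ d) (hh : 0 < h) {u : Fin d → ℝ} (hu : 0 ≤ u) (i : Fin d) :
    1 / h ^ 2 * ∑ n ∈ Finset.range (d - 1), (coordFn u (n + 1) - coordFn u n) *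
        (coordFn (bField d h p u) (n + 1) - coordFn (bField d h p u) n) -
      1 / h * ((coordFn u (d - 1) ^ p - coordFn u (d - 1)) * coordFn (bField d h p u) (d - 1)) ≤
      -(bField d h p u i ^ 2 / 2) := by
  obtain ⟨m, rfl⟩ : ∃ m, d = m + 2 := ⟨d - 2, by omega⟩
  have hmax : max (coordFn u (m + 1)) 0 = coordFn u (m + 1) := max_eq_left (coordFn_nonneg hu _)
  have hb : ∀ n (hn : n < m + 2), coordFn (bField (m + 2) h p u) n = bField (m + 2) h p u ⟨n, hn⟩ :=
    fun n hn => coordFn_of_lt _ hn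
  have hh2 : h ^ 2 ≠ 0 := by positivity
  have key := sum_mul_sub_sub_le_of_laplacian (x := coordFn u)
    (β := coordFn (bField (m + 2) h p u)) (r := h ^ 2)
    (G := h * (coordFn u (m + 1) ^ p - coordFn u (m + 1))) (m := m) (by positivity)
    (by
      rw [hb 0 (by omega), bField_eq, if_pos rfl]
      field_simp
      ring)
    (fun n hn => by
      rw [hb (n + 1) (by omega), bField_eq, if_neg (by simp), if_neg (by simp; omega)]
      simp only [add_tsub_cancel_right]
      field_simp)
    (by
      rw [hb (m + 1) (by omega), bField_eq, if_neg (by simp), if_pos (by simp)]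
      have e1 : m + 2 - 1 = m + 1 := by omega
      have e2 : m + 2 - 2 = m := by omega
      rw [e1, e2, hmax]
      field_simp) i.2
  rw [coordFn_val] at key
  have e1 : m + 2 - 1 = m + 1 := by omega
  rw [e1]
  have h1 := mul_le_mul_of_nonneg_left key (by positivity : 0 ≤ 1 / h ^ 2)
  refine le_of_eq_of_le ?_ (h1.trans_eq ?_)
  · field_simp
  · field_simp

theorem energy_ge (hh : 0 < h) (hp : 1 < p) {u : Fin d → ℝ} (hu : 0 ≤ u)
    (huR : ‖u‖ ≤ R) : -(1 / h * (R ^ (p + 1) / (p + 1))) ≤ energy h p u := by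
  have h1 : 0 ≤ 1 / (2 * h ^ 2) *
      ∑ n ∈ Finset.range (d - 1), (coordFn u (n + 1) - coordFn u n) ^ 2 :=
    mul_nonneg (by positivity) (Finset.sum_nonneg fun _ _ => sq_nonneg _)
  have h2 : coordFn u (d - 1) ^ (p + 1) ≤ R ^ (p + 1) :=
    Real.rpow_le_rpow (coordFn_nonneg hu _)
      ((le_abs_self _).trans ((abs_coordFn_le u _).trans huR)) (by linarith)
  have h3 : coordFn u (d - 1) ^ (p + 1) / (p + 1) ≤ R ^ (p + 1) / (p + 1) :=
    div_le_div_of_nonneg_right h2 (by linarith)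
  have h4 := mul_le_mul_of_nonneg_left
    (show coordFn u (d - 1) ^ (p + 1) / (p + 1) - coordFn u (d - 1) ^ 2 / 2 ≤
      R ^ (p + 1) / (p + 1) by linarith [sq_nonneg (coordFn u (d - 1))])
    (by positivity : 0 ≤ 1 / h)
  unfold energy
  linarith

theorem tendsto_bField_zero (hd : 2 ≤ d) (hh : 0 < h) (hp : 1 < p)
    (hU : IsIntegralCurveOn U (fun _ => bField d h p) (Ici 0))
    (h0 : ∀ t ∈ Ici (0 : ℝ), 0 ≤ U t) (hR : ∀ t ∈ Ici (0 : ℝ), ‖U t‖ ≤ R) (i : Fin d) :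
    Tendsto (fun t => bField d h p (U t) i) atTop (𝓝 0) := by
  obtain ⟨L, hL, hLip⟩ := abs_bField_sub_le (d := d) hh hp R
  have hR0 : 0 ≤ R := (norm_nonneg _).trans (hR 0 self_mem_Ici)
  have hb : ∀ t ∈ Ici (0 : ℝ), ‖bField d h p (U t)‖ ≤ L * R := fun t ht =>
    (pi_norm_le_iff_of_nonneg (by positivity)).2 fun j => by
      have := hLip (U t) 0 (hR t ht) (by simpa) j
      rw [bField_zero hp, Pi.zero_apply, sub_zero, sub_zero] at this
      exact this.trans (mul_le_mul_of_nonneg_left (hR t ht) hL)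
  refine tendsto_zero_of_dissipation (L := L * (L * R))
    (fun t ht => hasDerivWithinAt_energy hp (hU t ht))
    (fun t ht => energy_deriv_le hd hh (h0 t ht) i)
    (fun t ht => energy_ge hh hp (h0 t ht) (hR t ht)) (by positivity) fun s hs t ht => ?_
  rw [mul_assoc]
  refine (hLip _ _ (hR t ht) (hR s hs) i).trans (mul_le_mul_of_nonneg_left ?_ hL)
  exact Convex.norm_image_sub_le_of_norm_hasDerivWithin_le hU hb (convex_Ici 0) hs ht

theorem tendsto_zero_or_one (hd : 2 ≤ d) (hh : 0 < h) (hp : 1 < p)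
    (hU : IsIntegralCurveOn U (fun _ => bField d h p) (Ici 0))
    (h0 : ∀ t ∈ Ici (0 : ℝ), 0 ≤ U t) (hR : ∀ t ∈ Ici (0 : ℝ), ‖U t‖ ≤ R) :
    Tendsto U atTop (𝓝 0) ∨ Tendsto U atTop (𝓝 fun _ => 1) := by
  have hb := tendsto_bField_zero hd hh hp hU h0 hR
  have hh2 : h ^ 2 ≠ 0 := by positivity
  have hD : ∀ n, n + 1 < d →
      Tendsto (fun t => coordFn (U t) (n + 1) - coordFn (U t) n) atTop (𝓝 0) := by
    intro n
    induction n with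
    | zero =>
      intro hn
      have := (hb ⟨0, by omega⟩).const_mul (h ^ 2 / 2)
      rw [mul_zero] at this
      refine this.congr fun t => ?_
      rw [bField_eq, if_pos rfl]
      field_simp
      ring_nf
    | succ n ih =>
      intro hn
      have := ((hb ⟨n + 1, by omega⟩).const_mul (h ^ 2)).add (ih (by omega))
      rw [mul_zero, add_zero] at this
      refine this.congr fun t => ?_
      rw [bField_eq, if_neg (by simp), if_neg (by simp; omega)]
      simp only [add_tsub_cancel_right]
      field_simp
      ring
  have hlast : Tendsto (fun t => coordFn (U t) (d - 1) ^ p - coordFn (U t) (d - 1)) atTop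
      (𝓝 0) := by
    have := (((hb (lastIdx hd)).const_mul (h ^ 2 / 2)).add
      (hD (d - 2) (by omega))).const_mul (1 / h)
    rw [mul_zero, add_zero, mul_zero] at this
    refine this.congr' ?_
    filter_upwards [eventually_ge_atTop 0] with t ht
    have e : d - 2 + 1 = d - 1 := by omega
    have e0 : ¬ (lastIdx hd : ℕ) = 0 := by simp [lastIdx]; omega
    rw [bField_eq, if_neg e0, if_pos (show (lastIdx hd : ℕ) = d - 1 from rfl),
      max_eq_left (coordFn_nonneg (h0 t ht) _), e]
    field_simp
    ring
  have hcont : ContinuousOn (fun t => coordFn (U t) (d - 1)) (Ici 0) := fun t ht =>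
    (hasDerivWithinAt_coordFn (hU t ht) _).continuousWithinAt
  have hall : ∀ c : ℝ, Tendsto (fun t => coordFn (U t) (d - 1)) atTop (𝓝 c) →
      Tendsto U atTop (𝓝 fun _ => c) := by
    intro c hc
    have hdown : ∀ k ≤ d - 1, Tendsto (fun t => coordFn (U t) (d - 1 - k)) atTop (𝓝 c) := by
      intro k
      induction k with
      | zero => exact fun _ => hc
      | succ k ih =>
        intro hk
        have := (ih (by omega)).sub (hD (d - 1 - (k + 1)) (by omega))
        rw [sub_zero] at this
        refine this.congr fun t => ?_
        rw [show d - 1 - (k + 1) + 1 = d - 1 - k by omega]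
        ring
    refine tendsto_pi_nhds.2 fun i => (hdown (d - 1 - i) (by omega)).congr fun t => ?_
    rw [show d - 1 - (d - 1 - (i : ℕ)) = i by omega, coordFn_val]
  exact (tendsto_zero_or_one_of_rpow_sub_self hp hcont
    (fun t ht => coordFn_nonneg (h0 t ht) _) hlast).imp (hall 0) (hall 1)

end Convergence

section Dichotomy

variable {d : ℕ} {h p K : ℝ} {U : ℝ → Fin d → ℝ}

theorem norm_le_of_nonneg_of_le_const {u : Fin d → ℝ} {R : ℝ} (hR : 0 ≤ R) (hu : 0 ≤ u)
    (huR : u ≤ fun _ => R) : ‖u‖ ≤ R :=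
  (pi_norm_le_iff_of_nonneg hR).2 fun i => by
    rw [Real.norm_eq_abs, abs_of_nonneg (hu i)]
    exact huR i

theorem le_const_of_norm_le {u : Fin d → ℝ} {R : ℝ} (hR : ‖u‖ ≤ R) : u ≤ fun _ => R :=
  fun i => (le_abs_self _).trans ((norm_le_pi_norm u i).trans hR)

/-- Above the level `K`, the last coordinate of a nonnegative solution grows superlinearly. -/
def IsGrowthThreshold (hd : 2 ≤ d) (h p K : ℝ) : Prop :=
  1 ≤ K ∧ ∀ u : Fin d → ℝ, 0 ≤ u → K ≤ u (lastIdx hd) →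
    1 / h * u (lastIdx hd) ^ p ≤ bField d h p u (lastIdx hd)

theorem exists_isGrowthThreshold (hd : 2 ≤ d) (hh : 0 < h) (hp : 1 < p) :
    ∃ K, IsGrowthThreshold hd h p K := by
  have hq : 0 < p - 1 := by linarith
  have hB : 1 ≤ 2 * (1 + h) / h := by
    rw [le_div_iff₀ hh]
    linarith
  have hK1 : 1 ≤ (2 * (1 + h) / h) ^ (1 / (p - 1)) := Real.one_le_rpow hB (by positivity)
  refine ⟨_, hK1, fun u hu hK => ?_⟩
  have e0 : ¬ (lastIdx hd : ℕ) = 0 := by simp [lastIdx]; omega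
  have hx : coordFn u (d - 1) = u (lastIdx hd) := coordFn_val u (lastIdx hd)
  rw [bField_eq, if_neg e0, if_pos (show (lastIdx hd : ℕ) = d - 1 from rfl), hx,
    max_eq_left (show (0 : ℝ) ≤ u (lastIdx hd) from hu _)]
  set x := u (lastIdx hd)
  have hx0 : 0 < x := by linarith
  have h1 : 2 * (1 + h) / h ≤ x ^ (p - 1) := by
    have := Real.rpow_le_rpow (by linarith) hK hq.le
    rwa [← Real.rpow_mul (by linarith), one_div_mul_cancel hq.ne', Real.rpow_one] at this
  rw [div_le_iff₀ hh] at h1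
  have h2 : x ^ p = x * x ^ (p - 1) := by
    rw [Real.rpow_sub_one hx0.ne', mul_div_cancel₀ _ hx0.ne']
  have h3 := mul_le_mul_of_nonneg_left h1 hx0.le
  have h4 := coordFn_nonneg hu (d - 2)
  have e : 1 / h * x ^ p = 1 / h ^ 2 * (h * x ^ p) := by field_simp
  rw [e]
  refine mul_le_mul_of_nonneg_left ?_ (by positivity)
  have h5 : h * x ^ p = x * (x ^ (p - 1) * h) := by
    rw [h2]
    ring
  linarith

theorem last_ge_of_isGrowthThreshold {hd : 2 ≤ d} (hh : 0 < h) (hK : IsGrowthThreshold hd h p K)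
    {R a T : ℝ} (hR : K ≤ R) (hU : IsIntegralCurveOn U (fun _ => bField d h p) (Icc a T))
    (hpos : ∀ t ∈ Icc a T, 0 ≤ U t) (ha : R ≤ U a (lastIdx hd)) {t : ℝ} (ht : t ∈ Icc a T) :
    R ≤ U t (lastIdx hd) := by
  refine le_of_deriv_pos_above (fun s hs => hU.hasDerivWithinAt_apply hs _) (fun s hs hRs => ?_)
    ha ht
  have h1 := hK.2 _ (hpos s hs) (hR.trans hRs)
  have h2 : 0 < U s (lastIdx hd) := by linarith [hK.1]
  exact (mul_pos (by positivity) (Real.rpow_pos_of_pos h2 p)).trans_le h1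

theorem last_le_of_global {hd : 2 ≤ d} (hh : 0 < h) (hp : 1 < p)
    (hK : IsGrowthThreshold hd h p K) (hU : IsIntegralCurveOn U (fun _ => bField d h p) (Ici 0))
    (h0 : 0 ≤ U 0) {t : ℝ} (ht : 0 ≤ t) : U t (lastIdx hd) ≤ K := by
  by_contra! hlt
  refine no_global_superlinear (y := fun t => U t (lastIdx hd)) (a := t)
    (zero_lt_one.trans_le hK.1) (one_div_pos.2 hh) hp
    (fun s hs => hasDerivWithinAt_pi.1 ((hU s (ht.trans hs)).mono (Ici_subset_Ici.2 ht)) _)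
    (fun s hs => hK.2 _ (nonneg_of_nonneg_initial hh hp (hU.mono Icc_subset_Ici_self) h0
      (right_mem_Icc.2 (ht.trans hs)))) hlt.le

theorem abs_le_euclNorm (u : Fin d → ℝ) (i : Fin d) : |u i| ≤ euclNorm u :=
  Real.abs_le_sqrt (Finset.single_le_sum (f := fun i => u i ^ 2) (fun _ _ => sq_nonneg _)
    (Finset.mem_univ i))

/-- Some solution issued from `x` exceeds the level `K` at its last coordinate. -/
def Exceeds (hd : 2 ≤ d) (h p K : ℝ) (x : Fin d → ℝ) : Prop :=
  ∃ (T : ℝ) (U : ℝ → Fin d → ℝ), 0 ≤ T ∧ U 0 = x ∧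
    IsIntegralCurveOn U (fun _ => bField d h p) (Icc 0 T) ∧ K < U T (lastIdx hd)

theorem GlobalTo.not_exceeds {hd : 2 ≤ d} (hh : 0 < h) (hp : 1 < p)
    (hK : IsGrowthThreshold hd h p K) {x v : Fin d → ℝ} (hx : 0 ≤ x) (hg : GlobalTo d h p x v) :
    ¬ Exceeds hd h p K x := by
  rintro ⟨T, V, hT, hV0, hV, hVK⟩
  obtain ⟨U, hU0, hU, -⟩ := hg
  have hU' : IsIntegralCurveOn U (fun _ => bField d h p) (Ici 0) := hU
  have := IsIntegralCurveOn.eqOn_of_tame (locallyTame_bField hh hp) hV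
    (hU'.mono Icc_subset_Ici_self) (hV0.trans hU0.symm) (right_mem_Icc.2 hT)
  rw [this] at hVK
  exact not_le.2 hVK (last_le_of_global hh hp hK hU' (by rwa [hU0]) hT)

theorem globalTo_or_blowsUp {hd : 2 ≤ d} (hh : 0 < h) (hp : 1 < p)
    (hK : IsGrowthThreshold hd h p K) {x : Fin d → ℝ} (hx : 0 ≤ x) :
    GlobalTo d h p x 0 ∨ GlobalTo d h p x (fun _ => 1) ∨
      (BlowsUp d h p x ∧ Exceeds hd h p K x) := by
  rcases exists_global_or_unbounded (locallyTame_bField hh hp) x with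
    ⟨U, rfl, hU⟩ | ⟨τ, U, hτ, rfl, hU, hunb⟩
  · have hpos : ∀ t ∈ Ici (0 : ℝ), 0 ≤ U t := fun t ht =>
      nonneg_of_nonneg_initial hh hp (hU.mono Icc_subset_Ici_self) hx (right_mem_Icc.2 ht)
    have hR : ∀ t ∈ Ici (0 : ℝ), ‖U t‖ ≤ max K ‖U 0‖ := fun t ht =>
      norm_le_of_nonneg_of_le_const ((norm_nonneg _).trans (le_max_right _ _)) (hpos t ht)
        (le_const_of_last_le hd hh hp (hU.mono Icc_subset_Ici_self)
          (le_const_of_norm_le (le_max_right _ _))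
          (fun s hs => (last_le_of_global hh hp hK hU hx hs.1).trans (le_max_left _ _))
          (right_mem_Icc.2 ht))
    rcases tendsto_zero_or_one hd hh hp hU hpos hR with hlim | hlim
    · exact Or.inl ⟨U, rfl, hU, hlim⟩
    · exact Or.inr (Or.inl ⟨U, rfl, hU, hlim⟩)
  · right; right
    have hsub : ∀ {s t : ℝ}, 0 ≤ s → t < τ → Icc s t ⊆ Ico 0 τ := fun hs ht r hr =>
      ⟨hs.trans hr.1, hr.2.trans_lt ht⟩
    have hpos : ∀ t ∈ Ico 0 τ, 0 ≤ U t := fun t ht =>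
      nonneg_of_nonneg_initial hh hp (hU.mono (hsub le_rfl ht.2)) hx (right_mem_Icc.2 ht.1)
    have hlast : ∀ R, ∃ t ∈ Ico 0 τ, R < U t (lastIdx hd) := by
      intro R
      by_contra! H
      obtain ⟨t, ht, htM⟩ := hunb (max R ‖U 0‖)
      refine not_le.2 htM (norm_le_of_nonneg_of_le_const
        ((norm_nonneg _).trans (le_max_right _ _)) (hpos t ht)
        (le_const_of_last_le hd hh hp (hU.mono (hsub le_rfl ht.2))
          (le_const_of_norm_le (le_max_right _ _))
          (fun s hs => (H s (hsub le_rfl ht.2 hs)).trans (le_max_left _ _))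
          (right_mem_Icc.2 ht.1)))
    constructor
    · refine ⟨τ, U, hτ, rfl, hU, tendsto_atTop.2 fun R => ?_⟩
      obtain ⟨t, ht, htR⟩ := hlast (max R K)
      filter_upwards [Ioo_mem_nhdsLT ht.2] with s hs
      have hs' : Icc t s ⊆ Ico 0 τ := hsub ht.1 hs.2
      have := last_ge_of_isGrowthThreshold hh hK (le_max_right R K) (hU.mono hs')
        (fun r hr => hpos r (hs' hr)) htR.le (right_mem_Icc.2 hs.1.le)
      exact (((le_max_left _ _).trans this).trans (le_abs_self _)).trans (abs_le_euclNorm _ _)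
    · obtain ⟨t, ht, htK⟩ := hlast K
      exact ⟨t, U, ht.1, rfl, hU.mono (hsub le_rfl ht.2), htK⟩

theorem globalTo_zero_of_lt_one (hd : 2 ≤ d) (hh : 0 < h) (hp : 1 < p) {T : ℝ}
    (hT : 0 ≤ T) (hU : IsIntegralCurveOn U (fun _ => bField d h p) (Icc 0 T)) (h0 : 0 ≤ U 0)
    (hlt : ∀ i, U T i < 1) : GlobalTo d h p (U 0) 0 := by
  obtain ⟨K, hK⟩ := exists_isGrowthThreshold hd hh hp
  have hpos := fun t ht => nonneg_of_nonneg_initial hh hp hU h0 (t := t) ht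
  have hb := locallyTame_bField (d := d) hh hp
  rcases globalTo_or_blowsUp hh hp hK h0 with hg | ⟨V, hV0, hV, hlim⟩ | ⟨-, t, V, ht, hV0, hV, hVK⟩
  · exact hg
  · have hV' : IsIntegralCurveOn V (fun _ => bField d h p) (Ici 0) := hV
    have hVT : V T = U T := IsIntegralCurveOn.eqOn_of_tame hb (hV'.mono Icc_subset_Ici_self) hU
      hV0 (right_mem_Icc.2 hT)
    have hc : ‖U T‖ < 1 := (pi_norm_lt_iff one_pos).2 fun i => by
      rw [Real.norm_eq_abs, abs_of_nonneg (hpos T (right_mem_Icc.2 hT) i)]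
      exact hlt i
    have hle : ∀ t ≥ T, V t ≤ fun _ => ‖U T‖ := fun t ht =>
      le_const_of_le_one hd hh hp (norm_nonneg _) hc.le
        (hV'.mono fun s hs => hT.trans hs.1 : IsIntegralCurveOn V _ (Icc T t))
        (le_const_of_norm_le (by rw [hVT])) (right_mem_Icc.2 ht)
    have := le_of_tendsto hlim ((eventually_ge_atTop T).mono hle) (lastIdx hd)
    exact absurd hc (not_lt.2 this)
  · exfalso
    have hV1 : U T (lastIdx hd) < K := (hlt _).trans_le hK.1
    rcases le_total t T with htT | hTt
    · have hVt : V t = U t := IsIntegralCurveOn.eqOn_of_tame hb hV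
        (hU.mono (Icc_subset_Icc_right htT)) hV0 (right_mem_Icc.2 ht)
      rw [hVt] at hVK
      have := last_ge_of_isGrowthThreshold hh hK le_rfl (hU.mono (Icc_subset_Icc_left ht))
        (fun s hs => hpos s ⟨ht.trans hs.1, hs.2⟩) hVK.le (right_mem_Icc.2 htT)
      linarith
    · have hVT : V T = U T := IsIntegralCurveOn.eqOn_of_tame hb
        (hV.mono (Icc_subset_Icc_right hTt)) hU hV0 (right_mem_Icc.2 hT)
      have := le_const_of_le_one hd hh hp zero_le_one le_rfl (hV.mono (Icc_subset_Icc_left hT))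
        (fun i => by rw [hVT]; exact (hlt i).le) (right_mem_Icc.2 hTt) (lastIdx hd)
      simp only at this
      linarith [hK.1]

theorem GlobalTo.not_exceeds_of_smul_le {hd : 2 ≤ d} (hh : 0 < h) (hp : 1 < p)
    (hK : IsGrowthThreshold hd h p K) {x y v : Fin d → ℝ} {μ : ℝ} (hμ : 1 ≤ μ) (hx : 0 ≤ x)
    (hxy : μ • x ≤ y) (hg : GlobalTo d h p y v) : ¬ Exceeds hd h p K x := by
  rintro ⟨T, U, hT, rfl, hU, hUK⟩
  obtain ⟨V, rfl, hV, -⟩ := hg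
  have hV' : IsIntegralCurveOn V (fun _ => bField d h p) (Ici 0) := hV
  have hy : 0 ≤ V 0 := (smul_nonneg (by linarith) hx).trans hxy
  have h1 := smul_le_of_smul_initial_le hh hp hμ hU (hV'.mono Icc_subset_Ici_self) hxy
    (right_mem_Icc.2 hT) (lastIdx hd)
  have h2 := last_le_of_global hh hp hK hV' hy hT
  simp only [Pi.smul_apply, smul_eq_mul] at h1
  nlinarith [hK.1]

theorem GlobalTo.smul_le {x y v w : Fin d → ℝ} (hh : 0 < h) (hp : 1 < p) {μ : ℝ} (hμ : 1 ≤ μ)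
    (hxy : μ • x ≤ y) (hx : GlobalTo d h p x v) (hy : GlobalTo d h p y w) : μ • v ≤ w := by
  obtain ⟨U, rfl, hU, hUv⟩ := hx
  obtain ⟨V, rfl, hV, hVw⟩ := hy
  have hU' : IsIntegralCurveOn U (fun _ => bField d h p) (Ici 0) := hU
  have hV' : IsIntegralCurveOn V (fun _ => bField d h p) (Ici 0) := hV
  exact le_of_tendsto_of_tendsto (hUv.const_smul μ) hVw ((eventually_ge_atTop 0).mono fun t ht =>
    smul_le_of_smul_initial_le hh hp hμ (hU'.mono Icc_subset_Ici_self)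
      (hV'.mono Icc_subset_Ici_self) hxy (right_mem_Icc.2 ht))

end Dichotomy

/-- Critical scaling parameter: for every `u ≥ 0`, `u ≠ 0`, there is `λ_c > 0`
such that the solution from `λu` is global with limit `0` for `0 < λ < λ_c`, blows up in finite
time for `λ > λ_c`, and is global with limit `𝟙` for `λ = λ_c`. -/
theorem stmt11 (d : ℕ) (hd : 2 ≤ d) (h p : ℝ) (hh : 0 < h) (hp : 1 < p)
    (u : Fin d → ℝ) (hu : ∀ i, 0 ≤ u i) (hu0 : u ≠ 0) :
    ∃ lc : ℝ, 0 < lc ∧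
      (∀ l : ℝ, 0 < l → l < lc → GlobalTo d h p (l • u) 0) ∧
      (∀ l : ℝ, lc < l → BlowsUp d h p (l • u)) ∧
      GlobalTo d h p (lc • u) (fun _ => 1) := by
  have hu' : 0 ≤ u := hu
  have hb := locallyTame_bField (d := d) hh hp
  obtain ⟨K, hK⟩ := exists_isGrowthThreshold hd hh hp
  have hlu : ∀ {l : ℝ}, 0 < l → 0 ≤ l • u := fun hl => smul_nonneg hl.le hu'
  set A : Set ℝ := {l | 0 < l ∧ GlobalTo d h p (l • u) 0} with hA
  have hlocal : ∀ x : Fin d → ℝ, ∃ T > 0, ∃ U : ℝ → Fin d → ℝ, U 0 = x ∧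
      IsIntegralCurveOn U (fun _ => bField d h p) (Icc 0 T) := fun x =>
    exists_extension_of_bounded hb le_rfl (le_refl ‖x‖) (by simp)
  have hsmall : ∃ l, l ∈ A := by
    have hl : 0 < 1 / (‖u‖ + 1) := by positivity
    obtain ⟨T, hT, U, hU0, hU⟩ := hlocal ((1 / (‖u‖ + 1)) • u)
    refine ⟨1 / (‖u‖ + 1), hl, ?_⟩
    rw [← hU0]
    refine globalTo_zero_of_lt_one hd hh hp le_rfl (hU.mono (Icc_subset_Icc_right hT.le))
      (hU0 ▸ hlu hl) fun i => ?_
    have := le_const_of_norm_le (le_refl ‖u‖) i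
    simp only at this
    rw [hU0, Pi.smul_apply, smul_eq_mul, one_div_mul_eq_div, div_lt_one (by positivity)]
    linarith
  have hbdd : BddAbove A := by
    obtain ⟨T, hT, U, hU0, hU⟩ := hlocal u
    have hpos := pos_of_nonneg_of_ne_zero hd hh hp hT hU (hU0 ▸ hu') (hU0 ▸ hu0)
    refine ⟨1 + ∑ i, 1 / U T i, fun l hl => ?_⟩
    by_contra! hlt
    have hinv : ∀ i, 0 ≤ 1 / U T i := fun i => (one_div_pos.2 (hpos i)).le
    have hl1 : 1 ≤ l := by linarith [Finset.sum_nonneg fun i (_ : i ∈ Finset.univ) => hinv i]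
    obtain ⟨-, W, hW0, hW, hlim⟩ := hl
    have hW' : IsIntegralCurveOn W (fun _ => bField d h p) (Ici 0) := hW
    have h1 := smul_le_of_smul_initial_le hh hp hl1 hU (hW'.mono Icc_subset_Ici_self)
      (by rw [hU0, hW0]) (right_mem_Icc.2 hT.le)
    have h2 : (fun _ => 1) ≤ W T := fun i => by
      have h3 := Finset.single_le_sum (f := fun i => 1 / U T i) (fun i _ => hinv i)
        (Finset.mem_univ i)
      have h4 : 1 / U T i ≤ l := h3.trans (by linarith)
      rw [div_le_iff₀ (hpos i)] at h4
      exact h4.trans (h1 i)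
    have h3 := ge_of_tendsto hlim ((eventually_ge_atTop T).mono fun t ht =>
      one_le_of_one_le_initial hd hh hp
        (hW'.mono fun s hs => hT.le.trans hs.1 : IsIntegralCurveOn W _ (Icc T t)) h2
        (right_mem_Icc.2 ht))
    have := h3 (lastIdx hd)
    simp only [Pi.zero_apply] at this
    linarith
  have hlc : 0 < sSup A := by
    obtain ⟨l, hl⟩ := hsmall
    exact hl.1.trans_le (le_csSup hbdd hl)
  have hnear : ∀ δ > 0, ∃ η > 0, ∀ l, |l - sSup A| < η → dist (l • u) (sSup A • u) < δ := by
    intro δ hδ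
    have hc : Continuous fun l : ℝ => l • u := by fun_prop
    exact Metric.continuous_iff.1 hc (sSup A) δ hδ
  have hcrit : GlobalTo d h p (sSup A • u) (fun _ => 1) := by
    rcases globalTo_or_blowsUp hh hp hK (hlu hlc) with
      ⟨U, hU0, hU, hlim⟩ | hg | ⟨-, T, U, hT, hU0, hU, hUK⟩
    · exfalso
      have hU' : IsIntegralCurveOn U (fun _ => bField d h p) (Ici 0) := hU
      obtain ⟨T, hTU⟩ := Metric.tendsto_atTop.1 hlim (1 / 2) (by norm_num)
      have hT0 : 0 ≤ max T 0 := le_max_right _ _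
      have hUT := hTU (max T 0) (le_max_left _ _)
      obtain ⟨δ, hδ, hV⟩ := (hU'.mono Icc_subset_Ici_self).exists_nearby hb hT0
        (by norm_num : (0 : ℝ) < 1 / 2)
      obtain ⟨η, hη, hηδ⟩ := hnear δ hδ
      have hl : 0 < sSup A + η / 2 := by linarith
      obtain ⟨V, hV0, hV, hVU⟩ := hV ((sSup A + η / 2) • u) (by
        rw [hU0]
        exact hηδ _ (by rw [add_sub_cancel_left, abs_of_pos (by linarith)]; linarith))
      have hmem : sSup A + η / 2 ∈ A := by
        refine ⟨hl, ?_⟩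
        rw [← hV0]
        refine globalTo_zero_of_lt_one hd hh hp hT0 hV (hV0 ▸ hlu hl) fun i => ?_
        have h1 := dist_triangle (V (max T 0)) (U (max T 0)) 0
        have h2 := hVU _ (right_mem_Icc.2 hT0)
        rw [dist_zero_right] at h1
        have h3 := norm_le_pi_norm (V (max T 0)) i
        have h4 := le_abs_self (V (max T 0) i)
        rw [Real.norm_eq_abs] at h3
        linarith
      linarith [le_csSup hbdd hmem]
    · exact hg
    · exfalso
      obtain ⟨δ, hδ, hV⟩ := hU.exists_nearby hb hT (sub_pos.2 hUK)
      obtain ⟨η, hη, hηδ⟩ := hnear δ hδ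
      obtain ⟨l, hl, hlt⟩ := exists_lt_of_lt_csSup hsmall (sub_lt_self (sSup A) hη)
      have hle := le_csSup hbdd hl
      obtain ⟨V, hV0, hV, hVU⟩ := hV (l • u) (by
        rw [hU0]
        exact hηδ _ (abs_lt.2 ⟨by linarith, by linarith⟩))
      refine hl.2.not_exceeds hh hp hK (hlu hl.1) ⟨T, V, hT, hV0, hV, ?_⟩
      have h1 := (dist_le_pi_dist (V T) (U T) (lastIdx hd)).trans_lt
        (hVU T (right_mem_Icc.2 hT))
      rw [Real.dist_eq] at h1
      linarith [(abs_lt.1 h1).1]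
  have hscale : ∀ {l m : ℝ}, 0 < l → (m / l) • l • u = m • u := fun hl => by
    rw [smul_smul, div_mul_cancel₀ _ hl.ne']
  refine ⟨sSup A, hlc, fun l hl hlt => ?_, fun l hlt => ?_, hcrit⟩
  · have hμ : 1 < sSup A / l := (one_lt_div hl).2 hlt
    rcases globalTo_or_blowsUp hh hp hK (hlu hl) with hg | hg | ⟨-, hex⟩
    · exact hg
    · have := hg.smul_le hh hp hμ.le (hscale hl).le hcrit (lastIdx hd)
      simp only [Pi.smul_apply, smul_eq_mul, mul_one] at this
      linarith
    · exact absurd hex (hcrit.not_exceeds_of_smul_le hh hp hK hμ.le (hlu hl) (hscale hl).le)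
  · have hμ : 1 < l / sSup A := (one_lt_div hlc).2 hlt
    rcases globalTo_or_blowsUp hh hp hK (hlu (hlc.trans hlt)) with hg | hg | ⟨hbl, -⟩
    · have := hcrit.smul_le hh hp hμ.le (hscale hlc).le hg (lastIdx hd)
      simp only [Pi.smul_apply, smul_eq_mul, mul_one, Pi.zero_apply] at this
      linarith
    · have := hcrit.smul_le hh hp hμ.le (hscale hlc).le hg (lastIdx hd)
      simp only [Pi.smul_apply, smul_eq_mul, mul_one] at this
      linarith
    · exact hbl
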